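/- arXiv:2011.05465 — 2 statements merged into one kernel-verified Lean document; each statement's English description precedes it below -/
import Mathlib

section
/- The Vietoris hyperspace ℱ(𝔈) of all nonempty finite subsets of Erdős space 𝔈 is homogeneous; that is, for any two points F, G ∈ ℱ(𝔈) there exists a homeomorphism h : ℱ(𝔈) → ℱ(𝔈) with h(F) = G. -/
open Set Topology Filter

/-- The Vietoris topology on `Set X` induced by a topology `t` on `X`, generated by the
subbasic sets `{F | F ⊆ U}` and `{F | F ∩ U ≠ ∅}` for `U` open in `t`. -/
def vietoris {X : Type*} (t : TopologicalSpace X) : TopologicalSpace (Set X) :=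
  TopologicalSpace.generateFrom
    {S | (∃ U : Set X, IsOpen[t] U ∧ S = {F : Set X | F ⊆ U}) ∨
         (∃ U : Set X, IsOpen[t] U ∧ S = {F : Set X | (F ∩ U).Nonempty})}

/-- `ℱ(X)`: the hyperspace of nonempty finite subsets of `X`. -/
def FinHyp (X : Type*) : Type _ := {F : Set X // F.Finite ∧ F.Nonempty}

noncomputable instance FinHyp.instCoeOut {X : Type*} : CoeOut (FinHyp X) (Set X) :=
  ⟨Subtype.val⟩

/-- `ℱ(X)` carries the (subspace) Vietoris topology. -/
instance FinHyp.instTopologicalSpace {X : Type*} [t : TopologicalSpace X] :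
    TopologicalSpace (FinHyp X) :=
  (vietoris t).induced Subtype.val

/-- Erdős space: the set of square-summable sequences of rationals, as a subspace of the
real Hilbert space `ℓ²`. -/
noncomputable abbrev ErdosSpace : Type :=
  {x : lp (fun _ : ℕ => ℝ) 2 // ∀ n : ℕ, ∃ q : ℚ, x n = (q : ℝ)}

/-! ### Tails of series of nonnegative weights -/

/-- The weights `w` have uniformly small tails along the filter `l`. -/
def SmallTails {X : Type*} (l : Filter X) (w : X → ℕ → ℝ) : Prop :=
  ∀ ε > 0, ∃ n, ∀ᶠ y in l, ∑' k, w y (k + n) < ε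

theorem tsum_tail_antitone {f : ℕ → ℝ} (hf : ∀ n, 0 ≤ f n) (hs : Summable f) {m n : ℕ}
    (h : m ≤ n) : ∑' k, f (k + n) ≤ ∑' k, f (k + m) := by
  have h1 := hs.sum_add_tsum_nat_add m
  have h2 := hs.sum_add_tsum_nat_add n
  have h3 : ∑ i ∈ Finset.range m, f i ≤ ∑ i ∈ Finset.range n, f i :=
    Finset.sum_le_sum_of_subset_of_nonneg (Finset.range_mono h) fun i _ _ => hf i
  linarith

theorem SmallTails.exists_ge {X : Type*} {l : Filter X} {w : X → ℕ → ℝ}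
    (h : SmallTails l w) (hw : ∀ x n, 0 ≤ w x n) (hs : ∀ x, Summable (w x)) {ε : ℝ} (hε : 0 < ε)
    (N : ℕ) : ∃ n ≥ N, ∀ᶠ y in l, ∑' k, w y (k + n) < ε := by
  obtain ⟨n, hn⟩ := h ε hε
  refine ⟨max N n, le_max_left _ _, hn.mono fun y hy => ?_⟩
  exact (tsum_tail_antitone (hw y) (hs y) (le_max_right N n)).trans_lt hy

theorem summable_const_div_two_pow (C : ℝ) : Summable fun n : ℕ => C / 2 ^ n := by
  have := summable_geometric_two.mul_left C
  refine this.congr fun n => ?_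
  simp [div_eq_mul_inv]

theorem summable_of_close {f g : ℕ → ℝ} {C : ℝ} (h : ∀ n, |f n - g n| ≤ C / 2 ^ n)
    (hf : Summable f) : Summable g := by
  have h1 : Summable fun n => f n - g n :=
    Summable.of_norm_bounded (summable_const_div_two_pow C) fun n => h n
  exact (hf.sub h1).congr fun n => by ring

theorem SmallTails.of_close {X : Type*} {l : Filter X} {w v : X → ℕ → ℝ} {C : ℝ}
    (h : SmallTails l w) (hw : ∀ x n, 0 ≤ w x n) (hs : ∀ x, Summable (w x))
    (hc : ∀ x n, |w x n - v x n| ≤ C / 2 ^ n) : SmallTails l v := by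
  intro ε hε
  have ht := tendsto_sum_nat_add fun n : ℕ => C / 2 ^ n
  obtain ⟨N, hN⟩ := (ht.eventually (gt_mem_nhds (half_pos hε))).exists
  obtain ⟨n, hnN, hn⟩ := h.exists_ge hw hs (half_pos hε) N
  refine ⟨n, hn.mono fun y hy => ?_⟩
  have hC : ∀ n, 0 ≤ C / 2 ^ n := fun n => (abs_nonneg _).trans (hc y n)
  have h1 := tsum_tail_antitone hC (summable_const_div_two_pow C) hnN
  have hv := summable_of_close (hc y) (hs y)
  have h2 : ∑' k, v y (k + n) ≤ ∑' k, (w y (k + n) + C / 2 ^ (k + n)) := by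
    refine Summable.tsum_le_tsum (fun k => ?_) ((summable_nat_add_iff n).2 hv)
      (((summable_nat_add_iff n).2 (hs y)).add
        ((summable_nat_add_iff n).2 (summable_const_div_two_pow C)))
    have := (abs_le.1 (hc y (k + n))).1
    linarith
  rw [Summable.tsum_add ((summable_nat_add_iff n).2 (hs y))
        ((summable_nat_add_iff n).2 (summable_const_div_two_pow C))] at h2
  linarith

/-! ### The model space -/

/-- The model of Erdős space: sequences `(ρ, b, c)` of triples of natural numbers such that `ρ`
tends to infinity and `∑ bₙ / 2ⁿ` converges. -/
@[ext]
structure ErdosModel : Type where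
  /-- the sequence of triples -/
  val : ℕ → ℕ × ℕ × ℕ
  tendsto : Tendsto (fun n => (val n).1) atTop atTop
  summable : Summable fun n => ((val n).2.1 : ℝ) / 2 ^ n

namespace ErdosModel

/-- The weights of a point of the model. -/
noncomputable def wt (x : ErdosModel) (n : ℕ) : ℝ := ((x.1 n).2.1 : ℝ) / 2 ^ n

theorem wt_nonneg (x : ErdosModel) (n : ℕ) : 0 ≤ x.wt n := by unfold wt; positivity

theorem summable_wt (x : ErdosModel) : Summable x.wt := x.summable

/-- The topology of the model makes coordinates and the total weight continuous. -/
noncomputable instance : TopologicalSpace ErdosModel :=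
  TopologicalSpace.induced (fun x => (x.1, ∑' n, x.wt n))
    (inferInstance : TopologicalSpace ((ℕ → ℕ × ℕ × ℕ) × ℝ))

theorem continuous_val_prod :
    Continuous fun x : ErdosModel => (x.1, ∑' n, x.wt n) := continuous_induced_dom

/-- Agreement of the first `n` coordinates. -/
def Agree (n : ℕ) (x y : ErdosModel) : Prop := ∀ i < n, x.1 i = y.1 i

theorem Agree.symm {n : ℕ} {x y : ErdosModel} (h : Agree n x y) : Agree n y x :=
  fun i hi => (h i hi).symm

theorem Agree.trans {n : ℕ} {x y z : ErdosModel} (h : Agree n x y) (h' : Agree n y z) :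
    Agree n x z := fun i hi => (h i hi).trans (h' i hi)

theorem Agree.mono {m n : ℕ} {x y : ErdosModel} (h : Agree n x y) (hm : m ≤ n) :
    Agree m x y := fun i hi => h i (hi.trans_le hm)

theorem Agree.wt_eq {n : ℕ} {x y : ErdosModel} (h : Agree n x y) {i : ℕ} (hi : i < n) :
    x.wt i = y.wt i := by unfold wt; rw [h i hi]

theorem isOpen_agree (n : ℕ) (x : ErdosModel) : IsOpen {y | Agree n x y} := by
  have : {y | Agree n x y} = ⋂ i ∈ Finset.range n, {y : ErdosModel | x.1 i = y.1 i} := by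
    ext y; simp [Agree]
  rw [this]
  refine isOpen_biInter_finset fun i _ => ?_
  have hc : Continuous fun y : ErdosModel => y.1 i :=
    (continuous_apply i).comp (continuous_fst.comp continuous_val_prod)
  exact (isOpen_discrete {a | x.1 i = a}).preimage hc

theorem continuous_tail (n : ℕ) : Continuous fun x : ErdosModel => ∑' k, x.wt (k + n) := by
  have h : (fun x : ErdosModel => ∑' k, x.wt (k + n)) =
      fun x => ∑' k, x.wt k - ∑ i ∈ Finset.range n, x.wt i := by
    funext x
    rw [← x.summable_wt.sum_add_tsum_nat_add n]; ring
  rw [h]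
  refine (continuous_snd.comp continuous_val_prod).sub (continuous_finsetSum _ fun i _ => ?_)
  have hc : Continuous fun y : ErdosModel => y.1 i :=
    (continuous_apply i).comp (continuous_fst.comp continuous_val_prod)
  exact (continuous_of_discreteTopology
    (f := fun a : ℕ × ℕ × ℕ => (a.2.1 : ℝ) / 2 ^ i)).comp hc

theorem exists_of_mem_nhds {x : ErdosModel} {U : Set ErdosModel} (hU : U ∈ 𝓝 x) :
    ∃ ε > 0, ∃ N, ∀ n ≥ N, ∀ y, Agree n x y → ∑' k, y.wt (k + n) < ε → y ∈ U := by
  rw [nhds_induced, nhds_prod_eq, Filter.mem_comap] at hU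
  obtain ⟨V, hV, hVU⟩ := hU
  obtain ⟨A, hA, B, hB, hAB⟩ := Filter.mem_prod_iff.1 hV
  obtain ⟨δ, hδ, hδB⟩ := Metric.mem_nhds_iff.1 hB
  rw [nhds_pi, Filter.mem_pi'] at hA
  obtain ⟨I, t, ht, htA⟩ := hA
  obtain ⟨N, hN⟩ := ((tendsto_sum_nat_add x.wt).eventually (gt_mem_nhds hδ)).exists
  refine ⟨δ, hδ, max N (I.sup id + 1), fun n hn y hxy hy => hVU (hAB ⟨htA fun i hi => ?_, hδB ?_⟩)⟩
  · have hi' : i < n := by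
      have : i ≤ I.sup id := Finset.le_sup (f := id) hi
      have := le_of_max_le_right hn
      omega
    change y.1 i ∈ t i
    rw [← hxy i hi']
    exact mem_of_mem_nhds (ht i)
  · have h1 := x.summable_wt.sum_add_tsum_nat_add n
    have h2 := y.summable_wt.sum_add_tsum_nat_add n
    have h3 : ∑ i ∈ Finset.range n, x.wt i = ∑ i ∈ Finset.range n, y.wt i :=
      Finset.sum_congr rfl fun i hi => hxy.wt_eq (Finset.mem_range.1 hi)
    have h4 := tsum_tail_antitone x.wt_nonneg x.summable_wt (le_of_max_le_left hn)
    have h5 : 0 ≤ ∑' k, x.wt (k + n) := tsum_nonneg fun k => x.wt_nonneg _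
    have h6 : 0 ≤ ∑' k, y.wt (k + n) := tsum_nonneg fun k => y.wt_nonneg _
    rw [Metric.mem_ball, Real.dist_eq, abs_lt]
    constructor <;> linarith

theorem le_nhds_iff {x : ErdosModel} {l : Filter ErdosModel} :
    l ≤ 𝓝 x ↔ (∀ n, ∀ᶠ y in l, Agree n x y) ∧ SmallTails l wt := by
  constructor
  · intro h
    refine ⟨fun n => h ((isOpen_agree n x).mem_nhds fun i _ => rfl), fun ε hε => ?_⟩
    obtain ⟨n, hn⟩ := ((tendsto_sum_nat_add x.wt).eventually (gt_mem_nhds hε)).exists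
    exact ⟨n, h ((continuous_tail n).continuousAt.eventually (gt_mem_nhds hn))⟩
  · rintro ⟨h1, h2⟩ U hU
    obtain ⟨ε, hε, N, hN⟩ := exists_of_mem_nhds hU
    obtain ⟨n, hn, hn'⟩ := h2.exists_ge wt_nonneg summable_wt hε N
    filter_upwards [h1 n, hn'] with y hy hy' using hN n hn y hy hy'

end ErdosModel

/-! ### Spaces homeomorphic to the model -/

/-- A structure on a space `X` that identifies it with `ErdosModel`: nested countable partitions of
`X`, given by `rel`, together with flags and weights that are constant on the pieces. -/
structure ErdosStructure (X : Type*) [TopologicalSpace X] where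
  /-- lying in the same piece of the `n`-th partition -/
  rel : ℕ → Setoid X
  /-- the flag at a level -/
  flag : ℕ → X → ℕ
  /-- the weight at a level, in units of `2⁻ⁿ` -/
  bin : ℕ → X → ℕ
  rel_zero : ∀ x y, (rel 0).r x y
  rel_mono : ∀ n x y, (rel (n + 1)).r x y → (rel n).r x y
  countable_quotient : ∀ n, Countable (Quotient (rel n))
  flag_le : ∀ n x, flag n x ≤ n
  flag_congr : ∀ n x y, (rel (n + 1)).r x y → flag n x = flag n y
  bin_congr : ∀ n x y, (rel (n + 1)).r x y → bin n x = bin n y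
  full : ∀ n x ρ b, ρ ≤ n → ∃ y : ℕ → X,
    (∀ c, (rel n).r x (y c) ∧ flag n (y c) = ρ ∧ bin n (y c) = b) ∧
    ∀ c c', (rel (n + 1)).r (y c) (y c') → c = c'
  flag_tendsto : ∀ x, Tendsto (fun n => flag n x) atTop atTop
  bin_summable : ∀ x, Summable fun n => (bin n x : ℝ) / 2 ^ n
  eq_of_rel : ∀ x y, (∀ n, (rel n).r x y) → x = y
  complete : ∀ x : ℕ → X, (∀ n, (rel n).r (x n) (x (n + 1))) →
    Tendsto (fun n => flag n (x (n + 1))) atTop atTop →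
    Summable (fun n => (bin n (x (n + 1)) : ℝ) / 2 ^ n) → ∃ z, ∀ n, (rel n).r z (x n)
  le_nhds_iff : ∀ (x : X) (l : Filter X), l ≤ 𝓝 x ↔
    (∀ n, ∀ᶠ y in l, (rel n).r x y) ∧ SmallTails l fun y n => (bin n y : ℝ) / 2 ^ n

theorem exists_equiv_over_of_infinite_fibers {A B K : Type*} [Countable A] [Countable B]
    (f : A → K) (g : B → K) (hf : ∀ k, Infinite {a // f a = k})
    (hg : ∀ k, Infinite {b // g b = k}) : ∃ e : A ≃ B, ∀ a, g (e a) = f a := by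
  have h : ∀ k, Nonempty ({a // f a = k} ≃ {b // g b = k}) := fun k => by
    have := hf k
    have := hg k
    exact nonempty_equiv_of_countable
  refine ⟨(Equiv.sigmaFiberEquiv f).symm.trans
    ((Equiv.sigmaCongrRight fun k => (h k).some).trans (Equiv.sigmaFiberEquiv g)), fun a => ?_⟩
  exact ((h (f a)).some ⟨a, rfl⟩).2

namespace ErdosStructure

theorem exists_label {X : Type*} [TopologicalSpace X] (S : ErdosStructure X) (n : ℕ) : ∃ lab : X → ℕ × ℕ × ℕ,
    (∀ x, min (lab x).1 n = S.flag n x ∧ (lab x).2.1 = S.bin n x) ∧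
    (∀ x y, (S.rel n).r x y → (lab x = lab y ↔ (S.rel (n + 1)).r x y)) ∧
    ∀ x a, ∃ y, (S.rel n).r x y ∧ lab y = a := by
  have := S.countable_quotient n
  have := S.countable_quotient (n + 1)
  let f : Quotient (S.rel (n + 1)) → Quotient (S.rel n) × Fin (n + 1) × ℕ :=
    Quotient.lift (fun x => (Quotient.mk (S.rel n) x,
      ⟨S.flag n x, Nat.lt_succ_of_le (S.flag_le n x)⟩, S.bin n x)) fun x y h => by
        simp only [Prod.mk.injEq, Fin.mk.injEq]
        exact ⟨Quotient.sound (S.rel_mono n x y h), S.flag_congr n x y h, S.bin_congr n x y h⟩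
  let g : Quotient (S.rel n) × ℕ × ℕ × ℕ → Quotient (S.rel n) × Fin (n + 1) × ℕ :=
    fun p => (p.1, ⟨min p.2.1 n, by omega⟩, p.2.2.1)
  obtain ⟨e, he⟩ := exists_equiv_over_of_infinite_fibers f g (by
    rintro ⟨q, ρ, b⟩
    induction q using Quotient.inductionOn with | _ x
    obtain ⟨y, hy, hinj⟩ := S.full n x ρ b (Nat.le_of_lt_succ ρ.2)
    refine Infinite.of_injective
      (fun c => ⟨Quotient.mk (S.rel (n + 1)) (y c), ?_⟩) fun c c' h => ?_
    · simp only [f, Quotient.lift_mk, Prod.mk.injEq, Fin.ext_iff]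
      exact ⟨Quotient.sound ((S.rel n).symm (hy c).1), (hy c).2.1, (hy c).2.2⟩
    · exact hinj c c' (Quotient.exact (Subtype.ext_iff.1 h))) (by
    rintro ⟨q, ρ, b⟩
    refine Infinite.of_injective (fun c : ℕ => ⟨(q, (ρ : ℕ), b, c), ?_⟩) fun c c' h => ?_
    · simp only [g, Prod.mk.injEq, Fin.ext_iff, true_and, and_true]
      exact min_eq_left (Nat.le_of_lt_succ ρ.2)
    · simpa using h)
  have hg : ∀ x, g (e (Quotient.mk (S.rel (n + 1)) x)) = (Quotient.mk (S.rel n) x,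
      ⟨S.flag n x, Nat.lt_succ_of_le (S.flag_le n x)⟩, S.bin n x) := fun x => he _
  simp only [g, Prod.mk.injEq, Fin.mk.injEq] at hg
  refine ⟨fun x => (e (Quotient.mk (S.rel (n + 1)) x)).2, fun x => (hg x).2, fun x y h => ?_,
    fun x a => ?_⟩
  · constructor
    · intro h'
      refine Quotient.exact (e.injective (Prod.ext ?_ h'))
      rw [(hg x).1, (hg y).1]
      exact Quotient.sound h
    · intro h'
      change (e (Quotient.mk (S.rel (n + 1)) x)).2 = (e (Quotient.mk (S.rel (n + 1)) y)).2
      rw [show Quotient.mk (S.rel (n + 1)) x = Quotient.mk (S.rel (n + 1)) y from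
        Quotient.sound h']
  · obtain ⟨y, hy⟩ := Quotient.exists_rep (e.symm (Quotient.mk (S.rel n) x, a))
    refine ⟨y, Quotient.exact ?_, ?_⟩
    · rw [← (hg y).1, hy, e.apply_symm_apply]
    · change (e (Quotient.mk (S.rel (n + 1)) y)).2 = a
      rw [hy, e.apply_symm_apply]

/-- A space with an `ErdosStructure` is homeomorphic to `ErdosModel`. -/
theorem nonempty_homeomorph {X : Type*} [TopologicalSpace X] [Nonempty X]
    (S : ErdosStructure X) : Nonempty (X ≃ₜ ErdosModel) := by
  choose lab hlab hrel hex using S.exists_label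
  have hE : ∀ n x y, (S.rel n).r x y ↔ ∀ i < n, lab i x = lab i y := by
    intro n x y
    induction n with
    | zero => simp [S.rel_zero x y]
    | succ n ih =>
      constructor
      · intro h i hi
        have h' := S.rel_mono n x y h
        rcases Nat.lt_succ_iff_lt_or_eq.1 hi with hi | rfl
        · exact ih.1 h' i hi
        · exact (hrel i x y h').2 h
      · intro h
        exact (hrel n x y (ih.2 fun i hi => h i (by omega))).1 (h n (by omega))
  have hmem : ∀ x, Tendsto (fun n => (lab n x).1) atTop atTop ∧
      Summable fun n => ((lab n x).2.1 : ℝ) / 2 ^ n := by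
    refine fun x => ⟨tendsto_atTop_mono (fun n => ?_) (S.flag_tendsto x), ?_⟩
    · rw [← (hlab n x).1]; exact min_le_left _ _
    · simpa only [(hlab _ x).2] using S.bin_summable x
  let h : X → ErdosModel := fun x => ⟨fun n => lab n x, (hmem x).1, (hmem x).2⟩
  have hwt : ∀ x n, (h x).wt n = (S.bin n x : ℝ) / 2 ^ n := fun x n => by
    simp only [ErdosModel.wt, h, (hlab n x).2]
  have hagree : ∀ n x y, ErdosModel.Agree n (h x) (h y) ↔ (S.rel n).r x y :=
    fun n x y => (hE n x y).symm
  have hinj : Function.Injective h := fun x y hxy => S.eq_of_rel x y fun n =>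
    (hagree n x y).1 (by rw [hxy]; exact fun i _ => rfl)
  have hsurj : Function.Surjective h := by
    intro m
    let s : ℕ → X := fun n => Nat.rec (Classical.arbitrary X)
      (fun n x => (hex n x (m.1 n)).choose) n
    have hs : ∀ n, (S.rel n).r (s n) (s (n + 1)) ∧ lab n (s (n + 1)) = m.1 n :=
      fun n => (hex n (s n) (m.1 n)).choose_spec
    obtain ⟨z, hz⟩ := S.complete s (fun n => (hs n).1) (by
        have : ∀ n, S.flag n (s (n + 1)) = min (m.1 n).1 n := fun n => by
          rw [← (hs n).2, (hlab _ _).1]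
        simp only [this]
        exact tendsto_atTop.2 fun b => by
          filter_upwards [m.tendsto.eventually_ge_atTop b, eventually_ge_atTop b] with n h1 h2
            using le_min h1 h2) (by
        have : ∀ n, S.bin n (s (n + 1)) = (m.1 n).2.1 := fun n => by
          rw [← (hs n).2, (hlab _ _).2]
        simp only [this]
        exact m.summable)
    refine ⟨z, ErdosModel.ext (funext fun n => ?_)⟩
    rw [← (hs n).2]
    exact (hE (n + 1) z _).1 (hz (n + 1)) n (by omega)
  have key : ∀ x (l : Filter X), l ≤ 𝓝 x ↔ l.map h ≤ 𝓝 (h x) := by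
    intro x l
    rw [S.le_nhds_iff, ErdosModel.le_nhds_iff]
    simp only [SmallTails, eventually_map, hagree, hwt]
  let e : X ≃ ErdosModel := Equiv.ofBijective h ⟨hinj, hsurj⟩
  refine ⟨⟨e, ?_, ?_⟩⟩
  · exact continuous_iff_continuousAt.2 fun x => (key x _).1 le_rfl
  · refine continuous_iff_continuousAt.2 fun m => ?_
    obtain ⟨x, rfl⟩ := hsurj m
    have : e.symm (h x) = x := e.symm_apply_apply x
    change Filter.map e.symm (𝓝 (h x)) ≤ 𝓝 (e.symm (h x))
    rw [this, key, Filter.map_map]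
    have : h ∘ e.symm = id := funext fun m => e.apply_symm_apply m
    rw [this, Filter.map_id]

end ErdosStructure

/-! ### Finite hyperspaces -/

namespace FinHyp

variable {X : Type*}

instance : Membership X (FinHyp X) := ⟨fun F x => x ∈ F.1⟩

/-- A nonempty finite set as a point of the hyperspace. -/
def ofSet (s : Set X) (hf : s.Finite) (hn : s.Nonempty) : FinHyp X := ⟨s, hf, hn⟩

theorem finite (F : FinHyp X) : {x | x ∈ F}.Finite := F.2.1

theorem nonempty (F : FinHyp X) : {x | x ∈ F}.Nonempty := F.2.2

theorem ext {F G : FinHyp X} (h : ∀ x, x ∈ F ↔ x ∈ G) : F = G := Subtype.ext (Set.ext h)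

theorem le_nhds_iff [TopologicalSpace X] {F : FinHyp X} {l : Filter (FinHyp X)} :
    l ≤ 𝓝 F ↔
      (∀ U : Set X, IsOpen U → (∀ y ∈ F, y ∈ U) → ∀ᶠ G in l, ∀ y ∈ G, y ∈ U) ∧
      ∀ U : Set X, IsOpen U → (∃ y ∈ F, y ∈ U) → ∀ᶠ G in l, ∃ y ∈ G, y ∈ U := by
  have h1 : l ≤ 𝓝 F ↔ Tendsto (fun G : FinHyp X => G.1) l
      (@nhds (Set X) (vietoris inferInstance) F.1) := by
    rw [Tendsto, map_le_iff_le_comap]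
    exact iff_of_eq (congrArg (l ≤ ·) (@nhds_induced _ _ (vietoris inferInstance) _ F))
  rw [h1, vietoris, TopologicalSpace.tendsto_nhds_generateFrom_iff]
  constructor
  · intro h
    exact ⟨fun U hU hF => h _ (Or.inl ⟨U, hU, rfl⟩) hF, fun U hU hF => h _ (Or.inr ⟨U, hU, rfl⟩) hF⟩
  · rintro ⟨h, h'⟩ S (⟨U, hU, rfl⟩ | ⟨U, hU, rfl⟩) hF
    · exact h U hU hF
    · exact h' U hU hF

/-- The maximum of a function on a finite set. -/
noncomputable def mx (F : FinHyp X) (f : X → ℝ) : ℝ := sSup (f '' {x | x ∈ F})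

theorem le_mx {F : FinHyp X} (f : X → ℝ) {y : X} (hy : y ∈ F) : f y ≤ F.mx f :=
  le_csSup (F.finite.image f).bddAbove ⟨y, hy, rfl⟩

theorem exists_mx (F : FinHyp X) (f : X → ℝ) : ∃ y ∈ F, f y = F.mx f :=
  (F.nonempty.image f).csSup_mem (F.finite.image f)

theorem mx_const {F : FinHyp X} {f : X → ℝ} {a : ℝ} (h : ∀ y ∈ F, f y = a) : F.mx f = a := by
  obtain ⟨y, hy, h'⟩ := F.exists_mx f
  rw [← h', h y hy]

theorem mx_add_le {F : FinHyp X} {f g : X → ℝ} {a : ℝ} (h : ∀ y ∈ F, f y ≤ g y + a) :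
    F.mx f ≤ F.mx g + a := by
  obtain ⟨y, hy, h'⟩ := F.exists_mx f
  linarith [h y hy, le_mx g hy]

theorem mx_mono {F : FinHyp X} {f g : X → ℝ} (h : ∀ y ∈ F, f y ≤ g y) :
    F.mx f ≤ F.mx g := by
  simpa using mx_add_le (a := 0) (by simpa using h)

end FinHyp

namespace ErdosModel

/-- Two finite sets have the same truncations to the first `n` coordinates. -/
def SameTrunc (n : ℕ) (F G : FinHyp ErdosModel) : Prop :=
  (∀ y ∈ F, ∃ z ∈ G, Agree n y z) ∧ ∀ z ∈ G, ∃ y ∈ F, Agree n y z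

theorem SameTrunc.refl (n : ℕ) (F : FinHyp ErdosModel) : SameTrunc n F F :=
  ⟨fun y hy => ⟨y, hy, fun _ _ => rfl⟩, fun y hy => ⟨y, hy, fun _ _ => rfl⟩⟩

theorem SameTrunc.symm {n : ℕ} {F G : FinHyp ErdosModel} (h : SameTrunc n F G) :
    SameTrunc n G F :=
  ⟨fun z hz => (h.2 z hz).imp fun _ h' => ⟨h'.1, h'.2.symm⟩,
    fun y hy => (h.1 y hy).imp fun _ h' => ⟨h'.1, h'.2.symm⟩⟩

theorem SameTrunc.trans {n : ℕ} {F G H : FinHyp ErdosModel} (h : SameTrunc n F G)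
    (h' : SameTrunc n G H) : SameTrunc n F H := by
  refine ⟨fun y hy => ?_, fun y hy => ?_⟩
  · obtain ⟨z, hz, hyz⟩ := h.1 y hy
    obtain ⟨w, hw, hzw⟩ := h'.1 z hz
    exact ⟨w, hw, hyz.trans hzw⟩
  · obtain ⟨z, hz, hyz⟩ := h'.2 y hy
    obtain ⟨w, hw, hzw⟩ := h.2 z hz
    exact ⟨w, hw, hzw.trans hyz⟩

theorem SameTrunc.mono {m n : ℕ} {F G : FinHyp ErdosModel} (h : SameTrunc n F G)
    (hm : m ≤ n) : SameTrunc m F G :=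
  ⟨fun y hy => (h.1 y hy).imp fun _ h' => ⟨h'.1, h'.2.mono hm⟩,
    fun y hy => (h.2 y hy).imp fun _ h' => ⟨h'.1, h'.2.mono hm⟩⟩

theorem SameTrunc.mx_eq {n : ℕ} {F G : FinHyp ErdosModel} (h : SameTrunc n F G)
    {f : ErdosModel → ℝ} (hf : ∀ y z, Agree n y z → f y = f z) : F.mx f = G.mx f := by
  apply le_antisymm
  · obtain ⟨y, hy, h'⟩ := F.exists_mx f
    obtain ⟨z, hz, hyz⟩ := h.1 y hy
    rw [← h', hf y z hyz]
    exact FinHyp.le_mx f hz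
  · obtain ⟨z, hz, h'⟩ := G.exists_mx f
    obtain ⟨y, hy, hyz⟩ := h.2 z hz
    rw [← h', ← hf y z hyz]
    exact FinHyp.le_mx f hy

theorem eq_of_agree {y z : ErdosModel} (h : ∀ n, Agree n y z) : y = z :=
  ErdosModel.ext (funext fun i => h (i + 1) i (Nat.lt_succ_self i))

theorem eq_of_sameTrunc {F G : FinHyp ErdosModel} (h : ∀ n, SameTrunc n F G) : F = G := by
  have key : ∀ (F G : FinHyp ErdosModel), (∀ n, SameTrunc n F G) → ∀ y ∈ F, y ∈ G := by
    intro F G h y hy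
    by_contra hyG
    have : ∀ z ∈ {z | z ∈ G}, ∀ᶠ n in atTop, ¬ Agree n y z := by
      intro z hz
      have : ¬ ∀ n, Agree n y z := fun h' => hyG (eq_of_agree h' ▸ hz)
      push Not at this
      obtain ⟨m, hm⟩ := this
      filter_upwards [eventually_ge_atTop m] with n hn h' using hm (h'.mono hn)
    obtain ⟨n, hn⟩ := ((eventually_all_finite G.finite).2 this).exists
    obtain ⟨z, hz, hyz⟩ := (h n).1 y hy
    exact hn z hz hyz
  exact FinHyp.ext fun y => ⟨key F G h y, key G F (fun n => (h n).symm) y⟩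

theorem finHyp_le_nhds_iff {F : FinHyp ErdosModel} {l : Filter (FinHyp ErdosModel)} :
    l ≤ 𝓝 F ↔ (∀ n, ∀ᶠ G in l, SameTrunc n F G) ∧
      ∀ ε > 0, ∃ n, ∀ᶠ G in l, ∀ y ∈ G, ∑' k, y.wt (k + n) < ε := by
  rw [FinHyp.le_nhds_iff]
  constructor
  · rintro ⟨h1, h2⟩
    refine ⟨fun n => ?_, fun ε hε => ?_⟩
    · have ha : ∀ᶠ G in l, ∀ z ∈ G, z ∈ ⋃ y ∈ {y | y ∈ F}, {z | Agree n y z} :=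
        h1 _ (isOpen_biUnion fun y _ => isOpen_agree n y)
          fun y hy => mem_biUnion (show y ∈ {y | y ∈ F} from hy) fun _ _ => rfl
      have hb : ∀ᶠ G in l, ∀ y ∈ {y | y ∈ F}, ∃ z ∈ G, z ∈ {z | Agree n y z} :=
        (eventually_all_finite F.finite).2 fun y hy =>
          h2 _ (isOpen_agree n y) ⟨y, hy, fun _ _ => rfl⟩
      filter_upwards [ha, hb] with G hGa hGb
      refine ⟨hGb, fun z hz => ?_⟩
      simpa using hGa z hz
    · have : ∀ᶠ n in atTop, ∀ y ∈ {y | y ∈ F}, ∑' k, y.wt (k + n) < ε :=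
        (eventually_all_finite F.finite).2 fun y _ =>
          (tendsto_sum_nat_add y.wt).eventually (gt_mem_nhds hε)
      obtain ⟨n, hn⟩ := this.exists
      exact ⟨n, h1 {y | ∑' k, y.wt (k + n) < ε}
        (isOpen_Iio.preimage (continuous_tail n)) hn⟩
  · rintro ⟨h1, h2⟩
    have key : ∀ (U : Set ErdosModel) (y : ErdosModel), IsOpen U → y ∈ U →
        ∃ n, ∀ᶠ G in l, ∀ z ∈ G, Agree n y z → z ∈ U := by
      intro U y hU hy
      obtain ⟨ε, hε, N, hN⟩ := exists_of_mem_nhds (hU.mem_nhds hy)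
      obtain ⟨n, hn⟩ := h2 ε hε
      refine ⟨max N n, hn.mono fun G hG z hz hyz => hN _ (le_max_left _ _) z hyz ?_⟩
      exact (tsum_tail_antitone z.wt_nonneg z.summable_wt (le_max_right _ _)).trans_lt (hG z hz)
    refine ⟨fun U hU hF => ?_, fun U hU hF => ?_⟩
    · have : ∀ y : ErdosModel, ∃ n, y ∈ F → ∀ᶠ G in l, ∀ z ∈ G, Agree n y z → z ∈ U := by
        intro y
        by_cases hy : y ∈ F
        · exact (key U y hU (hF y hy)).imp fun n hn _ => hn
        · exact ⟨0, fun h => absurd h hy⟩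
      choose n hn using this
      obtain ⟨M, hM⟩ := (F.finite.image n).bddAbove
      have h3 : ∀ᶠ G in l, ∀ y ∈ {y | y ∈ F}, ∀ z ∈ G, Agree (n y) y z → z ∈ U :=
        (eventually_all_finite F.finite).2 hn
      filter_upwards [h1 M, h3] with G hG hG' z hz
      obtain ⟨y, hy, hyz⟩ := hG.2 z hz
      exact hG' y hy z hz (hyz.mono (hM ⟨y, hy, rfl⟩))
    · obtain ⟨y, hy, hyU⟩ := hF
      obtain ⟨n, hn⟩ := key U y hU hyU
      filter_upwards [h1 n, hn] with G hG hG'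
      obtain ⟨z, hz, hyz⟩ := hG.1 y hy
      exact ⟨z, hz, hG' z hz hyz⟩

/-! ### Weights on the finite hyperspace of the model -/

/-- Partial sums of the weights. -/
noncomputable def psum (l n : ℕ) (y : ErdosModel) : ℝ := ∑ i ∈ Finset.Ico l n, y.wt i

theorem psum_congr {l n : ℕ} {y z : ErdosModel} (h : Agree n y z) : psum l n y = psum l n z :=
  Finset.sum_congr rfl fun _ hi => h.wt_eq (Finset.mem_Ico.1 hi).2

theorem psum_mono (l : ℕ) {m n : ℕ} (h : m ≤ n) (y : ErdosModel) : psum l m y ≤ psum l n y :=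
  Finset.sum_le_sum_of_subset_of_nonneg (Finset.Ico_subset_Ico_right h)
    fun i _ _ => y.wt_nonneg i

theorem psum_of_le {l n : ℕ} (h : n ≤ l) (y : ErdosModel) : psum l n y = 0 := by
  simp [psum, Finset.Ico_eq_empty_of_le h]

theorem psum_succ {l n : ℕ} (h : l ≤ n) (y : ErdosModel) :
    psum l (n + 1) y = psum l n y + y.wt n := Finset.sum_Ico_succ_top h _

theorem psum_le_tail (l n : ℕ) (y : ErdosModel) : psum l n y ≤ ∑' k, y.wt (k + l) := by
  have h : psum l n y = ∑ k ∈ Finset.range (n - l), y.wt (k + l) := by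
    rw [psum, Finset.sum_Ico_eq_sum_range]
    exact Finset.sum_congr rfl fun k _ => by rw [add_comm]
  rw [h]
  exact ((summable_nat_add_iff l).2 y.summable_wt).sum_le_tsum _ fun k _ => y.wt_nonneg _

theorem psum_le_add_tail (l n N : ℕ) (y : ErdosModel) :
    psum l N y ≤ psum l n y + ∑' k, y.wt (k + n) := by
  have h : psum l N y ≤ psum l n y + psum n N y := by
    unfold psum
    rw [← Finset.sum_union (Finset.disjoint_left.2 fun i hi hi' => by
      simp only [Finset.mem_Ico] at hi hi'; omega)]
    refine Finset.sum_le_sum_of_subset_of_nonneg (fun i hi => ?_) fun i _ _ => y.wt_nonneg i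
    simp only [Finset.mem_union, Finset.mem_Ico] at hi ⊢
    omega
  linarith [psum_le_tail n N y]

theorem tail_le_of_psum_le {l : ℕ} {y : ErdosModel} {a : ℝ} (h : ∀ n, psum l n y ≤ a) :
    ∑' k, y.wt (k + l) ≤ a := by
  refine Real.tsum_le_of_sum_range_le (fun k => y.wt_nonneg _) fun n => ?_
  refine le_trans (le_of_eq ?_) (h (n + l))
  rw [psum, Finset.sum_Ico_eq_sum_range, Nat.add_sub_cancel]
  exact Finset.sum_congr rfl fun k _ => by rw [add_comm]

/-- The accumulated weight of a finite set. -/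
noncomputable def phi (n : ℕ) (F : FinHyp ErdosModel) : ℝ :=
  ∑ l ∈ Finset.range n, (1 / 2) ^ (l + 1) * F.mx (psum l n)

/-- The weight of a finite set at a given level. -/
noncomputable def omega (n : ℕ) (F : FinHyp ErdosModel) : ℝ := phi (n + 1) F - phi n F

theorem phi_congr {n : ℕ} {F G : FinHyp ErdosModel} (h : SameTrunc n F G) :
    phi n F = phi n G :=
  Finset.sum_congr rfl fun _ _ => by rw [h.mx_eq fun _ _ => psum_congr]

theorem omega_congr {n : ℕ} {F G : FinHyp ErdosModel} (h : SameTrunc (n + 1) F G) :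
    omega n F = omega n G := by
  rw [omega, omega, phi_congr h, phi_congr (h.mono n.le_succ)]

theorem phi_sub_phi {n N : ℕ} (h : n ≤ N) (F : FinHyp ErdosModel) : phi N F - phi n F =
    ∑ l ∈ Finset.range N, (1 / 2) ^ (l + 1) * (F.mx (psum l N) - F.mx (psum l n)) := by
  have : phi n F = ∑ l ∈ Finset.range N, (1 / 2) ^ (l + 1) * F.mx (psum l n) := by
    refine Finset.sum_subset (Finset.range_mono h) fun l _ hl => ?_
    have hl' : n ≤ l := by simpa using hl
    rw [FinHyp.mx_const fun y _ => psum_of_le hl' y, mul_zero]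
  rw [this, phi, ← Finset.sum_sub_distrib]
  exact Finset.sum_congr rfl fun _ _ => by ring

theorem le_phi_sub_phi {l n N : ℕ} (h : n ≤ N) (hl : l < N) (F : FinHyp ErdosModel) :
    (1 / 2) ^ (l + 1) * (F.mx (psum l N) - F.mx (psum l n)) ≤ phi N F - phi n F := by
  rw [phi_sub_phi h]
  exact Finset.single_le_sum (f := fun l => (1 / 2 : ℝ) ^ (l + 1) *
    (F.mx (psum l N) - F.mx (psum l n))) (fun l _ => mul_nonneg (by positivity)
      (sub_nonneg.2 (FinHyp.mx_mono fun y _ => psum_mono l h y))) (Finset.mem_range.2 hl)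

theorem phi_mono (F : FinHyp ErdosModel) {n N : ℕ} (h : n ≤ N) : phi n F ≤ phi N F := by
  refine sub_nonneg.1 ?_
  rw [phi_sub_phi h]
  exact Finset.sum_nonneg fun l _ => mul_nonneg (by positivity)
      (sub_nonneg.2 (FinHyp.mx_mono fun y _ => psum_mono l h y))

theorem omega_nonneg (n : ℕ) (F : FinHyp ErdosModel) : 0 ≤ omega n F :=
  sub_nonneg.2 (phi_mono F n.le_succ)

theorem sum_half_pow (n : ℕ) :
    ∑ l ∈ Finset.range n, (1 / 2 : ℝ) ^ (l + 1) = 1 - (1 / 2) ^ n := by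
  induction n with
  | zero => simp
  | succ n ih => rw [Finset.sum_range_succ, ih]; ring

theorem phi_sub_phi_le {n N : ℕ} (h : n ≤ N) (F : FinHyp ErdosModel) :
    phi N F - phi n F ≤ F.mx fun y => ∑' k, y.wt (k + n) := by
  set T := F.mx fun y => ∑' k, y.wt (k + n) with hT
  have hT0 : 0 ≤ T := by
    obtain ⟨y, hy⟩ := F.nonempty
    exact le_trans (tsum_nonneg fun k => y.wt_nonneg _)
      (FinHyp.le_mx (fun y : ErdosModel => ∑' k, y.wt (k + n)) hy)
  rw [phi_sub_phi h]
  calc _ ≤ ∑ l ∈ Finset.range N, (1 / 2 : ℝ) ^ (l + 1) * T := by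
        refine Finset.sum_le_sum fun l _ => mul_le_mul_of_nonneg_left ?_ (by positivity)
        have : F.mx (psum l N) ≤ F.mx (psum l n) + T := FinHyp.mx_add_le fun y hy => by
          have := FinHyp.le_mx (fun y : ErdosModel => ∑' k, y.wt (k + n)) hy
          linarith [psum_le_add_tail l n N y]
        linarith
    _ = (1 - (1 / 2) ^ N) * T := by rw [← Finset.sum_mul, sum_half_pow]
    _ ≤ 1 * T := by
        refine mul_le_mul_of_nonneg_right ?_ hT0
        have : (0 : ℝ) ≤ (1 / 2) ^ N := by positivity
        linarith
    _ = T := one_mul T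

theorem sum_omega (F : FinHyp ErdosModel) (n N : ℕ) :
    ∑ k ∈ Finset.range N, omega (k + n) F = phi (N + n) F - phi n F := by
  have := Finset.sum_range_sub (fun k => phi (k + n) F) N
  simp only [zero_add] at this
  rw [← this]
  exact Finset.sum_congr rfl fun k _ => by rw [omega, add_right_comm]

theorem summable_omega (F : FinHyp ErdosModel) : Summable fun n => omega n F := by
  refine summable_of_sum_range_le (c := F.mx fun y => ∑' k, y.wt (k + 0))
    (fun n => omega_nonneg n F) fun n => ?_
  have := sum_omega F 0 n
  simp only [add_zero] at this
  rw [this]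
  exact phi_sub_phi_le n.zero_le F

theorem tail_omega_le (F : FinHyp ErdosModel) (n : ℕ) :
    ∑' k, omega (k + n) F ≤ F.mx fun y => ∑' k, y.wt (k + n) :=
  Real.tsum_le_of_sum_range_le (fun k => omega_nonneg _ F) fun N => by
    rw [sum_omega]
    exact phi_sub_phi_le (Nat.le_add_left n N) F

theorem phi_sub_phi_le_tail {n N : ℕ} (h : n ≤ N) (F : FinHyp ErdosModel) :
    phi N F - phi n F ≤ ∑' k, omega (k + n) F := by
  have := sum_omega F n (N - n)
  rw [Nat.sub_add_cancel h] at this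
  rw [← this]
  exact ((summable_nat_add_iff n).2 (summable_omega F)).sum_le_tsum _
    fun k _ => omega_nonneg _ F

theorem smallTails_omega_iff {F : FinHyp ErdosModel} {l : Filter (FinHyp ErdosModel)}
    (hl : ∀ n, ∀ᶠ G in l, SameTrunc n F G) :
    SmallTails l (fun G n => omega n G) ↔
      ∀ ε > 0, ∃ n, ∀ᶠ G in l, ∀ y ∈ G, ∑' k, y.wt (k + n) < ε := by
  constructor
  · intro h ε hε
    have : ∀ᶠ m in atTop, ∀ y ∈ {y | y ∈ F}, ∑' k, y.wt (k + m) < ε / 2 :=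
      (eventually_all_finite F.finite).2 fun y _ =>
        (tendsto_sum_nat_add y.wt).eventually (gt_mem_nhds (half_pos hε))
    obtain ⟨m, hm⟩ := this.exists
    have hc : (0 : ℝ) < (1 / 2) ^ (m + 1) := by positivity
    obtain ⟨n, hn, hn'⟩ := h.exists_ge (fun G n => omega_nonneg n G) summable_omega
      (show (0 : ℝ) < (1 / 2) ^ (m + 1) * (ε / 4) by positivity) (m + 1)
    refine ⟨m, ?_⟩
    filter_upwards [hl n, hn'] with G hG hG' y hy
    have h1 : G.mx (psum m n) ≤ ε / 2 := by
      obtain ⟨z, hz, h'⟩ := G.exists_mx (psum m n)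
      obtain ⟨w, hw, hwz⟩ := hG.2 z hz
      rw [← h', ← psum_congr hwz]
      exact (psum_le_tail m n w).trans (hm w hw).le
    have h2 : ∑' k, y.wt (k + m) ≤ ε / 2 + ε / 4 := by
      refine tail_le_of_psum_le fun N => (psum_mono m (le_max_right n N) y).trans ?_
      have h3 := le_phi_sub_phi (l := m) (le_max_left n N)
        (lt_of_lt_of_le hn (le_max_left n N)) G
      have h4 := phi_sub_phi_le_tail (le_max_left n N) G
      have h5 := lt_of_mul_lt_mul_left (lt_of_le_of_lt (h3.trans h4) hG') hc.le
      linarith [FinHyp.le_mx (psum m (max n N)) hy]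
    linarith
  · intro h ε hε
    obtain ⟨n, hn⟩ := h ε hε
    refine ⟨n, hn.mono fun G hG => (tail_omega_le G n).trans_lt ?_⟩
    obtain ⟨y, hy, h'⟩ := G.exists_mx fun y => ∑' k, y.wt (k + n)
    rw [← h']
    exact hG y hy

/-- The integral weight of a finite set at a given level. -/
noncomputable def hbin (n : ℕ) (F : FinHyp ErdosModel) : ℕ := ⌊2 ^ n * omega n F⌋₊

theorem abs_omega_sub_hbin_le (F : FinHyp ErdosModel) (n : ℕ) :
    |omega n F - (hbin n F : ℝ) / 2 ^ n| ≤ 1 / 2 ^ n := by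
  have h2 : (0 : ℝ) < 2 ^ n := by positivity
  have h1 := Nat.floor_le (mul_nonneg h2.le (omega_nonneg n F))
  have h3 := Nat.lt_floor_add_one (2 ^ n * omega n F)
  have h4 : omega n F - (hbin n F : ℝ) / 2 ^ n = (2 ^ n * omega n F - hbin n F) / 2 ^ n := by
    field_simp
  rw [h4, abs_div, abs_of_pos h2]
  refine div_le_div_of_nonneg_right ?_ h2.le
  rw [abs_le]
  unfold hbin
  constructor <;> linarith

theorem abs_hbin_sub_omega_le (F : FinHyp ErdosModel) (n : ℕ) :
    |(hbin n F : ℝ) / 2 ^ n - omega n F| ≤ 1 / 2 ^ n := by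
  rw [abs_sub_comm]; exact abs_omega_sub_hbin_le F n

theorem summable_hbin (F : FinHyp ErdosModel) : Summable fun n => (hbin n F : ℝ) / 2 ^ n :=
  summable_of_close (abs_omega_sub_hbin_le F) (summable_omega F)

theorem smallTails_hbin_iff {l : Filter (FinHyp ErdosModel)} :
    SmallTails l (fun G n => (hbin n G : ℝ) / 2 ^ n) ↔ SmallTails l fun G n => omega n G :=
  ⟨fun h => h.of_close (fun _ _ => by positivity) summable_hbin abs_hbin_sub_omega_le,
    fun h => h.of_close (fun G n => omega_nonneg n G) summable_omega abs_omega_sub_hbin_le⟩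

/-! ### Flags on the finite hyperspace of the model -/

/-- No two points of the finite set first differ at coordinate `n`. -/
def NoSplit (n : ℕ) (F : FinHyp ErdosModel) : Prop :=
  ∀ y ∈ F, ∀ z ∈ F, Agree n y z → Agree (n + 1) y z

open Classical in
/-- The flag of a finite set at a given level. -/
noncomputable def hflag (n : ℕ) (F : FinHyp ErdosModel) : ℕ :=
  if NoSplit n F then min n (sInf ((fun y : ErdosModel => (y.val n).1) '' {y | y ∈ F})) else 0

theorem hflag_le (n : ℕ) (F : FinHyp ErdosModel) : hflag n F ≤ n := by
  unfold hflag
  split_ifs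
  · exact min_le_left _ _
  · exact n.zero_le

theorem hflag_le_of_mem {n : ℕ} {F : FinHyp ErdosModel} {y : ErdosModel} (hy : y ∈ F) :
    hflag n F ≤ (y.val n).1 := by
  unfold hflag
  split_ifs
  · exact (min_le_right _ _).trans (Nat.sInf_le ⟨y, hy, rfl⟩)
  · exact Nat.zero_le _

theorem noSplit_of_hflag_pos {n : ℕ} {F : FinHyp ErdosModel} (h : 0 < hflag n F) :
    NoSplit n F := by
  by_contra h'
  simp [hflag, h'] at h

theorem le_hflag {n b : ℕ} {F : FinHyp ErdosModel} (h : NoSplit n F) (hn : b ≤ n)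
    (hb : ∀ y ∈ F, b ≤ (y.val n).1) : b ≤ hflag n F := by
  rw [hflag, if_pos h]
  refine le_min hn (le_csInf (F.nonempty.image _) ?_)
  rintro _ ⟨y, hy, rfl⟩
  exact hb y hy

theorem SameTrunc.noSplit {n : ℕ} {F G : FinHyp ErdosModel} (h : SameTrunc (n + 1) F G)
    (hF : NoSplit n F) : NoSplit n G := by
  intro y hy z hz hyz
  obtain ⟨y', hy', hyy⟩ := h.2 y hy
  obtain ⟨z', hz', hzz⟩ := h.2 z hz
  exact hyy.symm.trans ((hF y' hy' z' hz' ((hyy.mono n.le_succ).trans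
    (hyz.trans (hzz.mono n.le_succ).symm))).trans hzz)

theorem hflag_congr {n : ℕ} {F G : FinHyp ErdosModel} (h : SameTrunc (n + 1) F G) :
    hflag n F = hflag n G := by
  have key : ∀ {F G : FinHyp ErdosModel}, SameTrunc (n + 1) F G → hflag n F ≤ hflag n G := by
    intro F G h
    rcases Nat.eq_zero_or_pos (hflag n F) with h0 | h0
    · omega
    · refine le_hflag (h.noSplit (noSplit_of_hflag_pos h0)) (hflag_le n F) fun z hz => ?_
      obtain ⟨y, hy, hyz⟩ := h.2 z hz
      rw [← hyz n n.lt_succ_self]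
      exact hflag_le_of_mem hy
  exact le_antisymm (key h) (key h.symm)

theorem eventually_noSplit (F : FinHyp ErdosModel) : ∀ᶠ n in atTop, NoSplit n F := by
  refine (eventually_all_finite F.finite).2 fun y hy => (eventually_all_finite F.finite).2
    fun z hz => ?_
  by_cases h : ∀ n, Agree n y z
  · exact Eventually.of_forall fun n _ => h (n + 1)
  · push Not at h
    obtain ⟨m, hm⟩ := h
    filter_upwards [eventually_ge_atTop m] with n hn h' using absurd (h'.mono hn) hm

theorem tendsto_hflag (F : FinHyp ErdosModel) :
    Tendsto (fun n => hflag n F) atTop atTop := by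
  refine tendsto_atTop.2 fun b => ?_
  have : ∀ᶠ n in atTop, ∀ y ∈ {y | y ∈ F}, b ≤ (y.val n).1 :=
    (eventually_all_finite F.finite).2 fun y _ => y.tendsto.eventually_ge_atTop b
  filter_upwards [eventually_noSplit F, this, eventually_ge_atTop b] with n h1 h2 h3
    using le_hflag h1 h3 h2

/-- Change one coordinate. -/
def upd (n : ℕ) (a : ℕ × ℕ × ℕ) (y : ErdosModel) : ErdosModel where
  val := Function.update y.val n a
  tendsto := y.tendsto.congr' <| by
    filter_upwards [eventually_gt_atTop n] with m hm
    rw [Function.update_of_ne hm.ne']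
  summable := by
    refine (summable_nat_add_iff (n + 1)).1
      (((summable_nat_add_iff (n + 1)).2 y.summable).congr fun m => ?_)
    rw [Function.update_of_ne (by omega)]

theorem upd_self (n : ℕ) (a : ℕ × ℕ × ℕ) (y : ErdosModel) : (upd n a y).val n = a :=
  Function.update_self ..

theorem agree_upd (n : ℕ) (a : ℕ × ℕ × ℕ) (y : ErdosModel) : Agree n y (upd n a y) :=
  fun _ hi => (Function.update_of_ne hi.ne _ _).symm

/-- Change one coordinate of all points of a finite set. -/
def hupd (n : ℕ) (a : ℕ × ℕ × ℕ) (F : FinHyp ErdosModel) : FinHyp ErdosModel :=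
  FinHyp.ofSet (upd n a '' {y | y ∈ F}) (F.finite.image _) (F.nonempty.image _)

theorem val_of_mem_hupd {n : ℕ} {a : ℕ × ℕ × ℕ} {F : FinHyp ErdosModel} {z : ErdosModel}
    (h : z ∈ hupd n a F) : z.val n = a := by
  obtain ⟨y, _, rfl⟩ := h
  exact upd_self n a y

theorem sameTrunc_hupd (n : ℕ) (a : ℕ × ℕ × ℕ) (F : FinHyp ErdosModel) :
    SameTrunc n F (hupd n a F) := by
  refine ⟨fun y hy => ⟨_, ⟨y, hy, rfl⟩, agree_upd n a y⟩, ?_⟩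
  rintro _ ⟨y, hy, rfl⟩
  exact ⟨y, hy, agree_upd n a y⟩

theorem hflag_hupd {n : ℕ} {a : ℕ × ℕ × ℕ} (h : a.1 ≤ n) (F : FinHyp ErdosModel) :
    hflag n (hupd n a F) = a.1 := by
  apply le_antisymm
  · obtain ⟨z, hz⟩ := (hupd n a F).nonempty
    rw [← congrArg Prod.fst (val_of_mem_hupd hz)]
    exact hflag_le_of_mem hz
  · refine le_hflag (fun y hy z hz hyz i hi => ?_) h fun z hz => by rw [val_of_mem_hupd hz]
    rcases Nat.lt_succ_iff_lt_or_eq.1 hi with hi | rfl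
    · exact hyz i hi
    · rw [val_of_mem_hupd hy, val_of_mem_hupd hz]

theorem omega_hupd (n : ℕ) (a : ℕ × ℕ × ℕ) (F : FinHyp ErdosModel) :
    omega n (hupd n a F) = (1 - (1 / 2) ^ (n + 1)) * (a.2.1 / 2 ^ n) := by
  rw [omega, phi_sub_phi n.le_succ, ← sum_half_pow, Finset.sum_mul]
  refine Finset.sum_congr rfl fun l hl => ?_
  have hl' : l ≤ n := Nat.lt_succ_iff.1 (Finset.mem_range.1 hl)
  have hw : ∀ z ∈ hupd n a F, psum l (n + 1) z = psum l n z + a.2.1 / 2 ^ n := fun z hz => by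
    rw [psum_succ hl', wt, val_of_mem_hupd hz]
  have h1 := FinHyp.mx_add_le fun z hz => (hw z hz).le
  have h2 : (hupd n a F).mx (psum l n) ≤
      (hupd n a F).mx (psum l (n + 1)) + -((a.2.1 : ℝ) / 2 ^ n) :=
    FinHyp.mx_add_le fun z hz => by linarith [hw z hz]
  congr 1
  linarith

theorem exists_hbin_hupd (n b : ℕ) : ∃ j : ℕ, ∀ ρ c F, hbin n (hupd n (ρ, j, c) F) = b := by
  set K : ℝ := 1 - (1 / 2) ^ (n + 1) with hK
  have hp : (0 : ℝ) < (1 / 2) ^ n := by positivity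
  have hp1 : (1 / 2 : ℝ) ^ n ≤ 1 := pow_le_one₀ (by norm_num) (by norm_num)
  have hK1 : K < 1 := by rw [hK, pow_succ]; linarith
  have hK0 : 0 < K := by rw [hK, pow_succ]; linarith
  refine ⟨⌈b / K⌉₊, fun ρ c F => ?_⟩
  have h1 : (2 : ℝ) ^ n * omega n (hupd n (ρ, ⌈b / K⌉₊, c) F) = K * ⌈b / K⌉₊ := by
    rw [omega_hupd, ← hK]; field_simp
  have h2 : (b : ℝ) ≤ K * ⌈b / K⌉₊ := by
    rw [← div_le_iff₀' hK0]; exact Nat.le_ceil _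
  have h3 : K * ⌈b / K⌉₊ < b + 1 := by
    have := Nat.ceil_lt_add_one (show 0 ≤ b / K by positivity)
    calc K * ⌈b / K⌉₊ < K * (b / K + 1) := mul_lt_mul_of_pos_left this hK0
      _ = b + K := by field_simp
      _ < b + 1 := by linarith
  rw [hbin, h1]
  exact (Nat.floor_eq_iff (by positivity)).2 ⟨h2, h3⟩

/-- The equivalence relation of having the same truncations. -/
def truncSetoid (n : ℕ) : Setoid (FinHyp ErdosModel) where
  r := SameTrunc n
  iseqv := ⟨SameTrunc.refl n, SameTrunc.symm, SameTrunc.trans⟩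

theorem countable_quotient_truncSetoid (n : ℕ) : Countable (Quotient (truncSetoid n)) := by
  classical
  let T : FinHyp ErdosModel → Finset (Fin n → ℕ × ℕ × ℕ) := fun F =>
    (F.finite.image fun y (i : Fin n) => y.val i).toFinset
  have hT : ∀ F G, T F = T G → ∀ y ∈ F, ∃ z ∈ G, Agree n y z := by
    intro F G h y hy
    have : (fun i : Fin n => y.val i) ∈ T G := by
      rw [← h]; simp only [T, Set.Finite.mem_toFinset]; exact ⟨y, hy, rfl⟩
    simp only [T, Set.Finite.mem_toFinset] at this
    obtain ⟨z, hz, hyz⟩ := this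
    exact ⟨z, hz, fun i hi => (congrFun hyz ⟨i, hi⟩).symm⟩
  refine Function.Injective.countable (f := fun q : Quotient (truncSetoid n) => T q.out)
    fun q q' h => ?_
  rw [← q.out_eq, ← q'.out_eq]
  refine Quotient.sound ⟨hT _ _ h, fun z hz => ?_⟩
  obtain ⟨y, hy, hyz⟩ := hT _ _ h.symm z hz
  exact ⟨y, hy, hyz.symm⟩

theorem exists_limit {F : ℕ → FinHyp ErdosModel} (hF : ∀ n, SameTrunc n (F n) (F (n + 1)))
    (hflag : Tendsto (fun n => hflag n (F (n + 1))) atTop atTop)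
    (hbin : Summable fun n => (hbin n (F (n + 1)) : ℝ) / 2 ^ n) :
    ∃ G, ∀ n, SameTrunc n G (F n) := by
  have hFF : ∀ n k, SameTrunc n (F n) (F (n + k)) := fun n k => by
    induction k with
    | zero => exact SameTrunc.refl n _
    | succ k ih => exact ih.trans ((hF (n + k)).mono (Nat.le_add_right n k))
  have ha : Summable fun n => omega n (F (n + 1)) :=
    summable_of_close (fun n => abs_hbin_sub_omega_le (F (n + 1)) n) hbin
  set A := ∑' n, omega n (F (n + 1)) with hA
  have hphi : ∀ n, phi n (F n) ≤ A := by
    intro n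
    have : phi n (F n) = ∑ k ∈ Finset.range n, omega k (F (k + 1)) := by
      induction n with
      | zero => simp [phi]
      | succ n ih => rw [Finset.sum_range_succ, ← ih, phi_congr (hF n), omega]; ring
    rw [this]
    exact ha.sum_le_tsum _ fun k _ => omega_nonneg k _
  have hA0 : 0 ≤ A := tsum_nonneg fun k => omega_nonneg k _
  have hpsum : ∀ n, ∀ z ∈ F n, psum 0 n z ≤ 2 * A := by
    intro n z hz
    rcases Nat.eq_zero_or_pos n with rfl | hn
    · rw [psum_of_le le_rfl]; linarith
    · have h1 := le_phi_sub_phi n.zero_le hn (F n)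
      rw [FinHyp.mx_const (f := psum 0 0) fun y _ => psum_of_le le_rfl y] at h1
      have h2 : phi 0 (F n) = 0 := by simp [phi]
      have h3 := FinHyp.le_mx (psum 0 n) hz
      have h4 := hphi n
      norm_num at h1
      linarith
  let Y : Set (ℕ → ℕ × ℕ × ℕ) := {y | ∀ n, ∃ z ∈ F n, ∀ i < n, y i = z.val i}
  have hYm : ∀ y ∈ Y, ∃ m : ErdosModel, m.val = y := by
    intro y hy
    refine ⟨⟨y, tendsto_atTop_mono (fun n => ?_) hflag, ?_⟩, rfl⟩
    · obtain ⟨z, hz, hyz⟩ := hy (n + 1)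
      rw [hyz n n.lt_succ_self]
      exact hflag_le_of_mem hz
    · refine summable_of_sum_range_le (c := 2 * A) (fun n => by positivity) fun n => ?_
      obtain ⟨z, hz, hyz⟩ := hy n
      refine le_trans (le_of_eq ?_) (hpsum n z hz)
      rw [psum, ← Finset.range_eq_Ico]
      exact Finset.sum_congr rfl fun i hi => by rw [wt, hyz i (Finset.mem_range.1 hi)]
  obtain ⟨n₀, hn₀⟩ := eventually_atTop.1 (hflag.eventually_ge_atTop 1)
  have hYfin : Y.Finite := by
    refine Set.Finite.of_finite_image (f := fun y (i : Fin n₀) => y i)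
      (((F n₀).finite.image fun y (i : Fin n₀) => y.val i).subset ?_) ?_
    · rintro _ ⟨y, hy, rfl⟩
      obtain ⟨z, hz, hyz⟩ := hy n₀
      exact ⟨z, hz, funext fun i => (hyz i i.2).symm⟩
    · intro y hy y' hy' h
      have : ∀ k, ∀ i < n₀ + k, y i = y' i := by
        intro k
        induction k with
        | zero => exact fun i hi => congrFun h ⟨i, hi⟩
        | succ k ih =>
          obtain ⟨z, hz, hyz⟩ := hy (n₀ + k + 1)
          obtain ⟨z', hz', hyz'⟩ := hy' (n₀ + k + 1)
          have h1 : Agree (n₀ + k) z z' := fun i hi => by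
            rw [← hyz i (by omega), ← hyz' i (by omega), ih i hi]
          have h2 := noSplit_of_hflag_pos (hn₀ (n₀ + k) (by omega)) z hz z' hz' h1
          intro i hi
          rw [hyz i (by omega), hyz' i (by omega)]
          exact h2 i (by omega)
      exact funext fun i => this (i + 1) i (by omega)
  have hext : ∀ n, ∀ z ∈ F n, ∃ y ∈ Y, ∀ i < n, y i = z.val i := by
    intro n z hz
    have hstep : ∀ m, ∀ w : {w // w ∈ F m}, ∃ w' : {w // w ∈ F (m + 1)},
        Agree m w.1 w'.1 := fun m w => by
      obtain ⟨w', hw', h⟩ := (hF m).1 w.1 w.2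
      exact ⟨⟨w', hw'⟩, h⟩
    choose next hnext using hstep
    let w : ∀ k, {w // w ∈ F (n + k)} := fun k => Nat.rec ⟨z, hz⟩ (fun k w => next (n + k) w) k
    have hw : ∀ k, Agree (n + k) (w k).1 (w (k + 1)).1 := fun k => hnext (n + k) (w k)
    have hww : ∀ k j, Agree (n + k) (w k).1 (w (k + j)).1 := fun k j => by
      induction j with
      | zero => exact fun _ _ => rfl
      | succ j ih => exact ih.trans ((hw (k + j)).mono (by omega))
    have hy : ∀ k, ∀ i < n + k, (w (i + 1)).1.val i = (w k).1.val i := by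
      intro k i hi
      rcases le_total k (i + 1) with h | h
      · obtain ⟨j, hj⟩ := Nat.exists_eq_add_of_le h
        rw [hj]
        exact (hww k j i hi).symm
      · obtain ⟨j, rfl⟩ := Nat.exists_eq_add_of_le h
        exact hww (i + 1) j i (by omega)
    refine ⟨fun i => (w (i + 1)).1.val i, fun m => ?_, fun i hi => hy 0 i hi⟩
    obtain ⟨x, hx, hxw⟩ := (hFF m n).2 (w m).1 (by rw [add_comm]; exact (w m).2)
    exact ⟨x, hx, fun i hi => (hy m i (by omega)).trans (hxw i hi).symm⟩
  refine ⟨FinHyp.ofSet {m | m.val ∈ Y} (hYfin.preimage fun a _ b _ h => ErdosModel.ext h) ?_,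
    fun n => ⟨fun m hm => hm n, fun z hz => ?_⟩⟩
  · obtain ⟨z, hz⟩ := (F 0).nonempty
    obtain ⟨y, hy, -⟩ := hext 0 z hz
    obtain ⟨m, rfl⟩ := hYm y hy
    exact ⟨m, hy⟩
  · obtain ⟨y, hy, hyz⟩ := hext n z hz
    obtain ⟨m, rfl⟩ := hYm y hy
    exact ⟨m, hy, hyz⟩

/-- The finite hyperspace of the model carries an `ErdosStructure`. -/
noncomputable def finHypStructure : ErdosStructure (FinHyp ErdosModel) where
  rel := truncSetoid
  flag := hflag
  bin := hbin
  rel_zero F G := by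
    obtain ⟨y, hy⟩ := F.nonempty
    obtain ⟨z, hz⟩ := G.nonempty
    exact ⟨fun _ _ => ⟨z, hz, fun i hi => absurd hi i.not_lt_zero⟩,
      fun _ _ => ⟨y, hy, fun i hi => absurd hi i.not_lt_zero⟩⟩
  rel_mono n _ _ h := SameTrunc.mono h n.le_succ
  countable_quotient := countable_quotient_truncSetoid
  flag_le := hflag_le
  flag_congr _ _ _ h := hflag_congr h
  bin_congr n F G h := by rw [hbin, hbin, omega_congr h]
  full n F ρ b hρ := by
    obtain ⟨j, hj⟩ := exists_hbin_hupd n b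
    refine ⟨fun c => hupd n (ρ, j, c) F, fun c =>
      ⟨sameTrunc_hupd n _ F, hflag_hupd hρ F, hj ρ c F⟩, fun c c' h => ?_⟩
    obtain ⟨y, hy⟩ := (hupd n (ρ, j, c) F).nonempty
    obtain ⟨z, hz, hyz⟩ := h.1 y hy
    have := hyz n n.lt_succ_self
    rw [val_of_mem_hupd hy, val_of_mem_hupd hz] at this
    simpa using this
  flag_tendsto := tendsto_hflag
  bin_summable := summable_hbin
  eq_of_rel _ _ := eq_of_sameTrunc
  complete _ h1 h2 h3 := exists_limit h1 h2 h3
  le_nhds_iff F l := by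
    rw [finHyp_le_nhds_iff, smallTails_hbin_iff]
    exact and_congr_right fun h => (smallTails_omega_iff h).symm

end ErdosModel

/-! ### Digit expansions of irrational numbers -/

namespace DyadicDigits

open Classical in
/-- The position of the leading binary digit of a number between `0` and `1`. -/
noncomputable def lead (f : ℝ) : ℕ :=
  if h : ∃ n : ℕ, f ∈ Ioo ((1 / 2 : ℝ) ^ (n + 1)) ((1 / 2) ^ n) then h.choose else 0

theorem lead_eq {f : ℝ} {n : ℕ} (h : f ∈ Ioo ((1 / 2 : ℝ) ^ (n + 1)) ((1 / 2) ^ n)) :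
    lead f = n := by
  have h' : ∃ n : ℕ, f ∈ Ioo ((1 / 2 : ℝ) ^ (n + 1)) ((1 / 2) ^ n) := ⟨n, h⟩
  have h1 := h'.choose_spec
  rw [lead, dif_pos h']
  have key : ∀ m k : ℕ, (1 / 2 : ℝ) ^ (m + 1) < f → f < (1 / 2) ^ k → k ≤ m := by
    intro m k hm hk
    have := (pow_lt_pow_iff_right_of_lt_one₀ (by norm_num : (0 : ℝ) < 1 / 2)
      (by norm_num)).1 (hm.trans hk)
    omega
  exact le_antisymm (key _ _ h.1 h1.2) (key _ _ h1.1 h.2)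

theorem lead_spec {f : ℝ} (hf : Irrational f) (h : f ∈ Ioo 0 1) :
    f ∈ Ioo ((1 / 2 : ℝ) ^ (lead f + 1)) ((1 / 2) ^ lead f) := by
  obtain ⟨n, hn, hn'⟩ := exists_nat_pow_near_of_lt_one h.1 h.2.le
    (by norm_num : (0 : ℝ) < 1 / 2) (by norm_num)
  have : f ≠ (1 / 2) ^ n := fun h' => hf ⟨(1 / 2) ^ n, by rw [h']; push_cast; rfl⟩
  have h1 : f ∈ Ioo ((1 / 2 : ℝ) ^ (n + 1)) ((1 / 2) ^ n) := ⟨hn, lt_of_le_of_ne hn' this⟩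
  rwa [lead_eq h1]

/-- Removal of the leading binary digit, followed by rescaling. -/
noncomputable def shift (f : ℝ) : ℝ := 2 ^ (lead f + 1) * f - 1

theorem irrational_shift {f : ℝ} (hf : Irrational f) : Irrational (shift f) := by
  have h1 : Irrational (((2 ^ (lead f + 1) : ℚ) : ℝ) * f - ((1 : ℚ) : ℝ)) :=
    (hf.ratCast_mul (by positivity)).sub_ratCast 1
  simpa [shift] using h1

theorem shift_mem {f : ℝ} (hf : Irrational f) (h : f ∈ Ioo 0 1) : shift f ∈ Ioo 0 1 := by
  obtain ⟨h1, h2⟩ := lead_spec hf h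
  have hp : (0 : ℝ) < 2 ^ lead f := by positivity
  rw [one_div, inv_pow] at h1 h2
  rw [inv_lt_iff_one_lt_mul₀ (by positivity)] at h1
  have h3 : 2 ^ lead f * f < 1 := by
    have := mul_lt_mul_of_pos_left h2 hp
    rwa [mul_inv_cancel₀ hp.ne'] at this
  unfold shift
  constructor
  · linarith
  · rw [pow_succ]; linarith

/-- The sequence of gaps between the binary digits equal to `1`. -/
noncomputable def dig (f : ℝ) : ℕ → ℕ
  | 0 => lead f
  | k + 1 => dig (shift f) k

theorem eventually_lead_eq {f : ℝ} (hf : Irrational f) (h : f ∈ Ioo 0 1) :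
    ∀ᶠ g in 𝓝 f, lead g = lead f := by
  filter_upwards [isOpen_Ioo.mem_nhds (lead_spec hf h)] with g hg using lead_eq hg

theorem tendsto_shift {f : ℝ} (hf : Irrational f) (h : f ∈ Ioo 0 1) :
    Tendsto shift (𝓝 f) (𝓝 (shift f)) := by
  have : Tendsto (fun g : ℝ => 2 ^ (lead f + 1) * g - 1) (𝓝 f) (𝓝 (shift f)) :=
    Continuous.tendsto (by fun_prop) f
  refine this.congr' ?_
  filter_upwards [eventually_lead_eq hf h] with g hg
  rw [shift, hg]

theorem eventually_dig_eq (k : ℕ) {f : ℝ} (hf : Irrational f) (h : f ∈ Ioo 0 1) :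
    ∀ᶠ g in 𝓝 f, ∀ j < k, dig g j = dig f j := by
  induction k generalizing f with
  | zero => simp
  | succ k ih =>
    filter_upwards [eventually_lead_eq hf h,
      (tendsto_shift hf h).eventually (ih (irrational_shift hf) (shift_mem hf h))] with g h1 h2 j hj
    cases j with
    | zero => exact h1
    | succ j => exact h2 j (by omega)

theorem abs_sub_le_of_dig_eq (k : ℕ) {f g : ℝ} (hf : Irrational f) (hf' : f ∈ Ioo 0 1)
    (hg : Irrational g) (hg' : g ∈ Ioo 0 1) (h : ∀ j < k, dig f j = dig g j) :
    |f - g| ≤ (1 / 2) ^ k := by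
  induction k generalizing f g with
  | zero =>
    rw [pow_zero, abs_le]
    constructor <;> linarith [hf'.1, hf'.2, hg'.1, hg'.2]
  | succ k ih =>
    have h0 : lead f = lead g := h 0 k.succ_pos
    have h1 := ih (irrational_shift hf) (shift_mem hf hf') (irrational_shift hg)
      (shift_mem hg hg') fun j hj => h (j + 1) (by omega)
    have h2 : shift f - shift g = 2 ^ (lead g + 1) * (f - g) := by
      rw [shift, shift, h0]; ring
    rw [h2, abs_mul, abs_of_pos (by positivity : (0 : ℝ) < 2 ^ (lead g + 1)), pow_succ] at h1
    have h3 : (1 : ℝ) ≤ 2 ^ lead g := one_le_pow₀ (by norm_num)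
    have h4 : |f - g| ≤ 2 ^ lead g * |f - g| := le_mul_of_one_le_left (abs_nonneg _) h3
    rw [pow_succ]
    linarith

theorem exists_dig_eq (k : ℕ) (u : ℕ → ℕ) :
    ∃ f, Irrational f ∧ f ∈ Ioo 0 1 ∧ ∀ j < k, dig f j = u j := by
  induction k generalizing u with
  | zero =>
    obtain ⟨r, hr, h⟩ := exists_irrational_btwn (zero_lt_one (α := ℝ))
    exact ⟨r, hr, h, by simp⟩
  | succ k ih =>
    obtain ⟨g, hg, hg', h⟩ := ih fun j => u (j + 1)
    have hp : (0 : ℝ) < 2 ^ u 0 := by positivity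
    have hmem : (1 + g) / 2 ^ (u 0 + 1) ∈
        Ioo ((1 / 2 : ℝ) ^ (u 0 + 1)) ((1 / 2) ^ u 0) := by
      rw [one_div, inv_pow, inv_pow]
      constructor
      · rw [inv_eq_one_div]
        exact div_lt_div_of_pos_right (by linarith [hg'.1]) (by positivity)
      · rw [div_lt_iff₀ (by positivity), pow_succ, inv_mul_cancel_left₀ hp.ne']
        linarith [hg'.2]
    have hlead := lead_eq hmem
    have hshift : shift ((1 + g) / 2 ^ (u 0 + 1)) = g := by
      rw [shift, hlead]; field_simp; ring
    refine ⟨(1 + g) / 2 ^ (u 0 + 1), ?_, ⟨lt_trans (by positivity) hmem.1,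
      hmem.2.trans_le (pow_le_one₀ (by norm_num) (by norm_num))⟩, fun j hj => ?_⟩
    · have := (hg.ratCast_add 1).div_ratCast (q := 2 ^ (u 0 + 1)) (by positivity)
      simpa using this
    · cases j with
      | zero => exact hlead
      | succ j => rw [dig, hshift]; exact h j (by omega)

/-- The digits of a real number, the first of which also contains the integer part. -/
noncomputable def digits (x : ℝ) : ℕ → ℕ
  | 0 => Encodable.encode (⌊x⌋, dig (Int.fract x) 0)
  | k + 1 => dig (Int.fract x) (k + 1)

theorem irrational_fract {x : ℝ} (hx : Irrational x) : Irrational (Int.fract x) :=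
  hx.sub_intCast ⌊x⌋

theorem fract_mem {x : ℝ} (hx : Irrational x) : Int.fract x ∈ Ioo (0 : ℝ) 1 :=
  ⟨lt_of_le_of_ne (Int.fract_nonneg x) (irrational_fract hx).ne_zero.symm, Int.fract_lt_one x⟩

theorem eventually_floor_eq {x : ℝ} (hx : Irrational x) : ∀ᶠ y in 𝓝 x, ⌊y⌋ = ⌊x⌋ := by
  have h := (fract_mem hx).1
  have : x ∈ Ioo (⌊x⌋ : ℝ) (⌊x⌋ + 1) := ⟨by rw [Int.fract] at h; linarith, Int.lt_floor_add_one x⟩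
  filter_upwards [isOpen_Ioo.mem_nhds this] with y hy
    using Int.floor_eq_iff.2 ⟨hy.1.le, hy.2⟩

theorem eventually_digits_eq (k : ℕ) {x : ℝ} (hx : Irrational x) :
    ∀ᶠ y in 𝓝 x, ∀ j < k, digits y j = digits x j := by
  have ht : Tendsto (Int.fract : ℝ → ℝ) (𝓝 x) (𝓝 (Int.fract x)) := by
    have : Tendsto (fun y : ℝ => y - ⌊x⌋) (𝓝 x) (𝓝 (Int.fract x)) :=
      Continuous.tendsto (by fun_prop) x
    refine this.congr' ?_
    filter_upwards [eventually_floor_eq hx] with y hy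
    rw [Int.fract, hy]
  filter_upwards [eventually_floor_eq hx,
    ht.eventually (eventually_dig_eq (k + 1) (irrational_fract hx) (fract_mem hx))] with y h1 h2 j hj
  cases j with
  | zero => rw [digits, digits, h1, h2 0 (by omega)]
  | succ j => exact h2 (j + 1) (by omega)

theorem abs_sub_le_of_digits_eq {k : ℕ} {x y : ℝ} (hx : Irrational x) (hy : Irrational y)
    (h : ∀ j < k + 1, digits x j = digits y j) : |x - y| ≤ (1 / 2) ^ k := by
  have h0 := Encodable.encode_injective (h 0 k.succ_pos)
  rw [Prod.mk.injEq] at h0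
  have h1 := abs_sub_le_of_dig_eq k (irrational_fract hx) (fract_mem hx) (irrational_fract hy)
    (fract_mem hy) fun j hj => by
      cases j with
      | zero => exact h0.2
      | succ j => exact h (j + 1) (by omega)
  rwa [Int.fract, Int.fract, h0.1, sub_sub_sub_cancel_right] at h1

theorem exists_digits_eq (k : ℕ) (u : ℕ → ℕ) :
    ∃ x, Irrational x ∧ ∀ j < k, digits x j = u j := by
  set a := Denumerable.ofNat (ℤ × ℕ) (u 0) with ha
  obtain ⟨f, hf, hf', h⟩ := exists_dig_eq k fun j => if j = 0 then a.2 else u j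
  have h1 : ⌊(a.1 : ℝ) + f⌋ = a.1 := by
    rw [Int.floor_intCast_add, Int.floor_eq_zero_iff.2 ⟨hf'.1.le, hf'.2⟩, add_zero]
  have h2 : Int.fract ((a.1 : ℝ) + f) = f := by rw [Int.fract, h1]; ring
  refine ⟨a.1 + f, hf.intCast_add _, fun j hj => ?_⟩
  cases j with
  | zero =>
    have h3 : dig f 0 = a.2 := by simpa using h 0 hj
    rw [digits, h1, h2, h3, Prod.mk.eta, ha, Denumerable.encode_ofNat]
  | succ j => rw [digits, h2]; simpa using h (j + 1) hj

/-! ### Digit expansions of rational numbers -/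

/-- A rescaled signed square, translated by an irrational number. -/
noncomputable def row (i : ℕ) (r : ℝ) : ℝ := 2 ^ i * (r * |r|) + √2

theorem continuous_row (i : ℕ) : Continuous (row i) := by unfold row; fun_prop

theorem irrational_row (i : ℕ) (q : ℚ) : Irrational (row i q) := by
  have := irrational_sqrt_two.ratCast_add (2 ^ i * (q * |q|))
  simpa [row] using this

theorem surjective_row (i : ℕ) : Function.Surjective (row i) := by
  intro x
  set t := (x - √2) / 2 ^ i with ht
  have h2 : x = 2 ^ i * t + √2 := by rw [ht]; field_simp; ring
  rcases le_total 0 t with h | h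
  · refine ⟨√t, ?_⟩
    rw [row, abs_of_nonneg (Real.sqrt_nonneg _), Real.mul_self_sqrt h, ← h2]
  · refine ⟨-√(-t), ?_⟩
    rw [row, abs_neg, abs_of_nonneg (Real.sqrt_nonneg _), neg_mul,
      Real.mul_self_sqrt (neg_nonneg.2 h), neg_neg, ← h2]

theorem sq_sub_le (r s : ℝ) : (r - s) ^ 2 ≤ 2 * |r * (|r|) - s * (|s|)| := by
  have h1 := le_abs_self (r * (|r|) - s * (|s|))
  have h2 := neg_abs_le (r * (|r|) - s * (|s|))
  generalize |r * (|r|) - s * (|s|)| = A at h1 h2 ⊢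
  rcases abs_cases r with ⟨hr, hr'⟩ | ⟨hr, hr'⟩ <;>
    rcases abs_cases s with ⟨hs, hs'⟩ | ⟨hs, hs'⟩ <;> rw [hr, hs] at h1 h2
  · rcases le_total r s with h | h
    · nlinarith [mul_nonneg hr' (sub_nonneg.2 h)]
    · nlinarith [mul_nonneg hs' (sub_nonneg.2 h)]
  · nlinarith [sq_nonneg (r + s)]
  · nlinarith [sq_nonneg (r + s)]
  · rcases le_total r s with h | h
    · nlinarith [mul_nonneg (neg_pos.2 hs').le (sub_nonneg.2 h)]
    · nlinarith [mul_nonneg (neg_pos.2 hr').le (sub_nonneg.2 h)]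

/-- The digits of a rational number in a given row. -/
noncomputable def code (i : ℕ) (q : ℚ) : ℕ → ℕ := digits (row i q)

theorem code_locally_constant (i k : ℕ) (q : ℚ) :
    ∀ᶠ r : ℝ in 𝓝 (q : ℝ), ∀ q' : ℚ, (q' : ℝ) = r → ∀ j < k, code i q j = code i q' j := by
  filter_upwards [(continuous_row i).continuousAt.eventually
    (eventually_digits_eq k (irrational_row i q))] with r hr q' hq' j hj
  rw [code, code, hq', hr j hj]

theorem exists_code_separates (i : ℕ) {ε : ℝ} (hε : 0 < ε) : ∃ k, ∀ q q' : ℚ,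
    (∀ j < k, code i q j = code i q' j) → |(q' : ℝ) - q| < ε := by
  obtain ⟨k, hk⟩ := exists_pow_lt_of_lt_one (show 0 < ε ^ 2 / 2 by positivity)
    (by norm_num : (1 / 2 : ℝ) < 1)
  refine ⟨k + 1, fun q q' h => ?_⟩
  have h1 := abs_sub_le_of_digits_eq (irrational_row i q) (irrational_row i q') h
  have h2 : row i q - row i q' = 2 ^ i * ((q : ℝ) * |(q : ℝ)| - q' * |(q' : ℝ)|) := by
    unfold row; ring
  rw [h2, abs_mul, abs_of_pos (by positivity : (0 : ℝ) < 2 ^ i)] at h1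
  have h3 := le_mul_of_one_le_left (abs_nonneg ((q : ℝ) * |(q : ℝ)| - q' * |(q' : ℝ)|))
    (one_le_pow₀ (by norm_num : (1 : ℝ) ≤ 2) (n := i))
  have h4 := sq_sub_le q q'
  rw [abs_sub_comm]
  exact abs_lt_of_sq_lt_sq (by linarith) hε.le

theorem exists_code_eq (i k : ℕ) (u : ℕ → ℕ) : ∃ q : ℚ, ∀ j < k, code i q j = u j := by
  obtain ⟨x, hx, hxu⟩ := exists_digits_eq k u
  obtain ⟨r, rfl⟩ := surjective_row i x
  have h := (continuous_row i).continuousAt.eventually (eventually_digits_eq k hx)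
  obtain ⟨q, hq⟩ := (Rat.denseRange_cast (𝕜 := ℝ)).exists_mem_open isOpen_interior
    ⟨r, mem_interior_iff_mem_nhds.2 h⟩
  exact ⟨q, fun j hj => (interior_subset hq j hj).trans (hxu j hj)⟩

theorem eq_of_code_eq {i : ℕ} {q q' : ℚ} (h : ∀ j, code i q j = code i q' j) : q = q' := by
  by_contra hne
  have : (0 : ℝ) < |(q' : ℝ) - q| := abs_pos.2 (sub_ne_zero.2 (by exact_mod_cast Ne.symm hne))
  obtain ⟨k, hk⟩ := exists_code_separates i this
  exact lt_irrefl _ (hk q q' fun j _ => h j)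

/-- The weight contained in the first digit. -/
def weight (a : ℕ) : ℕ := (Denumerable.ofNat (ℤ × ℕ) a).1.natAbs

theorem abs_weight_sub_le (i : ℕ) (q : ℚ) :
    |(weight (code i q 0) : ℝ) / 2 ^ i - (q : ℝ) ^ 2| ≤ 3 / 2 ^ i := by
  have hp : (0 : ℝ) < 2 ^ i := by positivity
  have h1 : weight (code i q 0) = ⌊row i q⌋.natAbs := by
    simp only [weight, code, digits, Denumerable.ofNat_encode]
  have h2 : (weight (code i q 0) : ℝ) = |(⌊row i q⌋ : ℝ)| := by
    rw [h1, Nat.cast_natAbs, Int.cast_abs]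
  have h3 : (q : ℝ) ^ 2 = |2 ^ i * ((q : ℝ) * |(q : ℝ)|)| / 2 ^ i := by
    rw [abs_mul, abs_mul, abs_abs, abs_mul_abs_self, abs_of_pos hp]; field_simp
  rw [h2, h3, ← sub_div, abs_div, abs_of_pos hp]
  refine div_le_div_of_nonneg_right ((abs_abs_sub_abs_le_abs_sub _ _).trans ?_) hp.le
  have h4 := Int.floor_le (row i q)
  have h5 := Int.lt_floor_add_one (row i q)
  have h6 : √2 ≤ 2 := by rw [Real.sqrt_le_left (by norm_num)]; norm_num
  have h7 := Real.sqrt_nonneg 2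
  rw [abs_le]
  unfold row at *
  constructor <;> linarith

theorem weight_encode (b c : ℕ) : weight (Encodable.encode ((b : ℤ), c)) = b := by
  simp only [weight, Denumerable.ofNat_encode, Int.natAbs_natCast]

end DyadicDigits

/-! ### Erdős space -/

namespace ErdosSpace

/-- The rational coordinates of a point. -/
noncomputable def co (x : ErdosSpace) (n : ℕ) : ℚ := (x.2 n).choose

theorem co_spec (x : ErdosSpace) (n : ℕ) : (co x n : ℝ) = x.1 n := ((x.2 n).choose_spec).symm

theorem ext_co {x y : ErdosSpace} (h : ∀ n, co x n = co y n) : x = y :=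
  Subtype.ext (lp.ext (funext fun n => by rw [← co_spec, ← co_spec, h n]))

theorem hasSum_norm_sq (f : lp (fun _ : ℕ => ℝ) 2) : HasSum (fun n => f n ^ 2) (‖f‖ ^ 2) := by
  have := lp.hasSum_norm (p := 2) (by norm_num) f
  simpa using this

theorem summable_co (x : ErdosSpace) : Summable fun n => (co x n : ℝ) ^ 2 := by
  simpa only [co_spec] using (hasSum_norm_sq x.1).summable

theorem exists_of_summable (f : ℕ → ℚ) (hf : Summable fun n => (f n : ℝ) ^ 2) :
    ∃ x : ErdosSpace, ∀ n, co x n = f n := by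
  have h : Memℓp (E := fun _ : ℕ => ℝ) (fun n => (f n : ℝ)) 2 :=
    (memℓp_gen_iff (by norm_num)).2 (hf.congr fun n => by simp [-Rat.norm_cast_real])
  let x : ErdosSpace := ⟨⟨fun n => (f n : ℝ), h⟩, fun n => ⟨f n, rfl⟩⟩
  exact ⟨x, fun n => Rat.cast_injective (α := ℝ) (co_spec x n)⟩

theorem hasSum_dist_sq (x y : ErdosSpace) :
    HasSum (fun n => ((co y n : ℝ) - co x n) ^ 2) (dist y x ^ 2) := by
  have := hasSum_norm_sq (y.1 - x.1)
  rw [← dist_eq_norm, ← Subtype.dist_eq] at this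
  simpa only [co_spec, lp.coeFn_sub, Pi.sub_apply] using this

theorem le_nhds_iff_co {x : ErdosSpace} {l : Filter ErdosSpace} :
    l ≤ 𝓝 x ↔ (∀ n, Tendsto (fun y => (co y n : ℝ)) l (𝓝 (co x n))) ∧
      SmallTails l fun y n => (co y n : ℝ) ^ 2 := by
  have hsq : ∀ a b : ℝ, a ^ 2 ≤ 2 * b ^ 2 + 2 * (a - b) ^ 2 := fun a b => by
    nlinarith [sq_nonneg (a - 2 * b)]
  have hsq' : ∀ a b : ℝ, (a - b) ^ 2 ≤ 2 * a ^ 2 + 2 * b ^ 2 := fun a b => by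
    nlinarith [sq_nonneg (a + b)]
  constructor
  · intro h
    constructor
    · intro n
      rw [Metric.tendsto_nhds]
      intro ε hε
      filter_upwards [h (Metric.ball_mem_nhds x hε)] with y hy
      have h1 := le_hasSum (hasSum_dist_sq x y) n fun m _ => sq_nonneg _
      exact (abs_le_of_sq_le_sq h1 dist_nonneg).trans_lt hy
    · intro ε hε
      obtain ⟨n, hn⟩ := ((tendsto_sum_nat_add fun n => (co x n : ℝ) ^ 2).eventually
        (gt_mem_nhds (show 0 < ε / 4 by positivity))).exists
      refine ⟨n, ?_⟩
      filter_upwards [h (Metric.ball_mem_nhds x (show 0 < √(ε / 4) by positivity))] with y hy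
      have h1 : dist y x ^ 2 < ε / 4 := by
        rw [← Real.lt_sqrt dist_nonneg]; exact hy
      have hs := (hasSum_dist_sq x y).summable
      have h2 := tsum_tail_antitone (fun n => sq_nonneg _) hs n.zero_le
      simp only [add_zero] at h2
      rw [(hasSum_dist_sq x y).tsum_eq] at h2
      have hx := (summable_nat_add_iff n).2 (summable_co x)
      have hd := (summable_nat_add_iff n).2 hs
      have h3 := Summable.tsum_le_tsum (fun k => hsq (co y (k + n)) (co x (k + n)))
        ((summable_nat_add_iff n).2 (summable_co y)) ((hx.mul_left 2).add (hd.mul_left 2))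
      rw [Summable.tsum_add (hx.mul_left 2) (hd.mul_left 2), tsum_mul_left, tsum_mul_left] at h3
      linarith
  · rintro ⟨h1, h2⟩
    refine Metric.nhds_basis_ball.ge_iff.2 fun ε hε => ?_
    obtain ⟨N, hN⟩ := ((tendsto_sum_nat_add fun n => (co x n : ℝ) ^ 2).eventually
      (gt_mem_nhds (show 0 < ε ^ 2 / 8 by positivity))).exists
    obtain ⟨n, hnN, hn⟩ := h2.exists_ge (fun y n => sq_nonneg _) summable_co
      (show 0 < ε ^ 2 / 8 by positivity) N
    have h3 : Tendsto (fun y => ∑ i ∈ Finset.range n, ((co y i : ℝ) - co x i) ^ 2) l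
        (𝓝 (∑ i ∈ Finset.range n, ((co x i : ℝ) - co x i) ^ 2)) :=
      tendsto_finsetSum _ fun i _ => ((h1 i).sub_const _).pow 2
    simp only [sub_self, ne_eq, OfNat.ofNat_ne_zero, not_false_eq_true, zero_pow,
      Finset.sum_const_zero] at h3
    filter_upwards [hn, h3.eventually (gt_mem_nhds (show 0 < ε ^ 2 / 2 by positivity))]
      with y hy hy'
    have hs := (hasSum_dist_sq x y).summable
    have h4 := hs.sum_add_tsum_nat_add n
    rw [(hasSum_dist_sq x y).tsum_eq] at h4
    have hx := (summable_nat_add_iff n).2 (summable_co x)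
    have hy2 := (summable_nat_add_iff n).2 (summable_co y)
    have h5 := Summable.tsum_le_tsum (fun k => hsq' (co y (k + n)) (co x (k + n)))
      ((summable_nat_add_iff n).2 hs) ((hy2.mul_left 2).add (hx.mul_left 2))
    rw [Summable.tsum_add (hy2.mul_left 2) (hx.mul_left 2), tsum_mul_left, tsum_mul_left] at h5
    have h6 := tsum_tail_antitone (fun n => sq_nonneg (co x n : ℝ)) (summable_co x) hnN
    exact lt_of_pow_lt_pow_left₀ 2 hε.le (by linarith)

/-! ### Least representatives of cells -/

open DyadicDigits

/-- Two rational numbers have the same first `k` digits. -/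
def SameCode (i k : ℕ) (q q' : ℚ) : Prop := ∀ j < k, code i q j = code i q' j

theorem SameCode.symm {i k : ℕ} {q q' : ℚ} (h : SameCode i k q q') : SameCode i k q' q :=
  fun j hj => (h j hj).symm

theorem SameCode.trans {i k : ℕ} {q q' q'' : ℚ} (h : SameCode i k q q')
    (h' : SameCode i k q' q'') : SameCode i k q q'' := fun j hj => (h j hj).trans (h' j hj)

theorem SameCode.mono {i k m : ℕ} {q q' : ℚ} (h : SameCode i k q q') (hm : m ≤ k) :
    SameCode i m q q' := fun j hj => h j (hj.trans_le hm)

/-- The least index of a rational number with the same first `k` digits. -/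
noncomputable def leastIndex (i k : ℕ) (q : ℚ) : ℕ :=
  sInf (Encodable.encode '' {q' | SameCode i k q q'})

theorem exists_leastIndex (i k : ℕ) (q : ℚ) :
    ∃ q', SameCode i k q q' ∧ Encodable.encode q' = leastIndex i k q :=
  Nat.sInf_mem (Set.Nonempty.image (s := {q' | SameCode i k q q'}) _ ⟨q, fun _ _ => rfl⟩)

theorem leastIndex_le {i k : ℕ} {q q' : ℚ} (h : SameCode i k q q') :
    leastIndex i k q ≤ Encodable.encode q' := Nat.sInf_le ⟨q', h, rfl⟩

theorem leastIndex_congr {i k : ℕ} {q q' : ℚ} (h : SameCode i k q q') :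
    leastIndex i k q = leastIndex i k q' := by
  have key : ∀ {q q' : ℚ}, SameCode i k q q' → leastIndex i k q ≤ leastIndex i k q' := by
    intro q q' h
    obtain ⟨r, hr, hr'⟩ := exists_leastIndex i k q'
    rw [← hr']
    exact leastIndex_le (h.trans hr)
  exact le_antisymm (key h) (key h.symm)

theorem leastIndex_mono (i : ℕ) (q : ℚ) : Monotone fun k => leastIndex i k q := by
  intro k m hkm
  obtain ⟨r, hr, hr'⟩ := exists_leastIndex i m q
  change leastIndex i k q ≤ leastIndex i m q
  rw [← hr']
  exact leastIndex_le (hr.mono hkm)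

theorem eventually_leastIndex_succ (i : ℕ) (q : ℚ) :
    ∀ᶠ k in atTop, leastIndex i k q = leastIndex i (k + 1) q := by
  have hb : BddAbove (range fun k => leastIndex i k q) :=
    ⟨Encodable.encode q, by rintro _ ⟨k, rfl⟩; exact leastIndex_le fun _ _ => rfl⟩
  obtain ⟨K, hK⟩ := Nat.sSup_mem (range_nonempty fun k => leastIndex i k q) hb
  filter_upwards [eventually_ge_atTop K] with k hk
  have h1 := leastIndex_mono i q hk
  have h2 := le_csSup hb ⟨k + 1, rfl⟩
  have h3 := leastIndex_mono i q k.le_succ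
  simp only [Nat.succ_eq_add_one] at hK h1 h2 h3
  omega

theorem exists_same_limit {i : ℕ} {q : ℕ → ℚ} (h : ∀ k, SameCode i k (q k) (q (k + 1)))
    (h' : ∀ᶠ k in atTop, leastIndex i k (q (k + 1)) = leastIndex i (k + 1) (q (k + 1))) :
    ∃ z, ∀ k, SameCode i k z (q k) := by
  obtain ⟨K, hK⟩ := eventually_atTop.1 h'
  have hc : ∀ m, leastIndex i (K + m) (q (K + m)) = leastIndex i K (q K) := fun m => by
    induction m with
    | zero => rfl
    | succ m ih =>
      rw [← ih, leastIndex_congr (h (K + m)), hK (K + m) (Nat.le_add_right K m)]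
      rfl
  have hq : ∀ k m, SameCode i k (q k) (q (k + m)) := fun k m => by
    induction m with
    | zero => exact fun _ _ => rfl
    | succ m ih => exact ih.trans ((h (k + m)).mono (Nat.le_add_right k m))
  obtain ⟨z, -, hz⟩ := exists_leastIndex i K (q K)
  have hzK : ∀ m, SameCode i (K + m) (q (K + m)) z := fun m => by
    obtain ⟨z', h1, h2⟩ := exists_leastIndex i (K + m) (q (K + m))
    rw [hc, ← hz] at h2
    rwa [Encodable.encode_injective h2] at h1
  refine ⟨z, fun k => ?_⟩
  have h1 := (hzK k).mono (Nat.le_add_left k K)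
  rw [add_comm] at h1
  exact ((hq k K).trans h1).symm

/-! ### The structure on Erdős space -/

/-- The least index changes in row `i` at level `n`. -/
def Moves (n i : ℕ) (q : ℚ) : Prop := leastIndex i (n - i) q ≠ leastIndex i (n - i + 1) q

theorem moves_congr {n i : ℕ} {q q' : ℚ} (h : SameCode i (n - i + 1) q q') :
    Moves n i q ↔ Moves n i q' := by
  rw [Moves, Moves, leastIndex_congr h, leastIndex_congr (h.mono (Nat.le_succ _))]

theorem eventually_not_moves (i : ℕ) (q : ℚ) : ∀ᶠ n in atTop, ¬ Moves n i q := by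
  filter_upwards [(tendsto_sub_atTop_nat i).eventually (eventually_leastIndex_succ i q)]
    with n hn using not_not.2 hn

theorem exists_not_moves (n i : ℕ) (q : ℚ) :
    ∃ q', SameCode i (n - i) q q' ∧ ¬ Moves n i q' := by
  obtain ⟨r, hr, hr'⟩ := exists_leastIndex i (n - i) q
  refine ⟨r, hr, not_not.2 (le_antisymm (leastIndex_mono i r (Nat.le_succ _)) ?_)⟩
  rw [← leastIndex_congr hr, ← hr']
  exact leastIndex_le fun _ _ => rfl

theorem exists_moves (n i : ℕ) (q : ℚ) :
    ∃ q', SameCode i (n - i) q q' ∧ Moves n i q' := by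
  obtain ⟨r, hr, hr'⟩ := exists_leastIndex i (n - i) q
  obtain ⟨q', hq'⟩ := exists_code_eq i (n - i + 1)
    fun j => if j < n - i then code i q j else code i r j + 1
  have h1 : SameCode i (n - i) q q' := fun j hj => by rw [hq' j (by omega), if_pos hj]
  refine ⟨q', h1, fun h => ?_⟩
  obtain ⟨s, hs, hs'⟩ := exists_leastIndex i (n - i + 1) q'
  rw [← h, ← leastIndex_congr h1, ← hr'] at hs'
  have h2 := hs (n - i) (Nat.lt_succ_self _)
  rw [Encodable.encode_injective hs', hq' _ (Nat.lt_succ_self _), if_neg (lt_irrefl _)] at h2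
  omega

/-- The first row in which the least index changes at a given level. -/
noncomputable def eflag (n : ℕ) (x : ErdosSpace) : ℕ := sInf {i | i < n → Moves n i (co x i)}

theorem eflag_le (n : ℕ) (x : ErdosSpace) : eflag n x ≤ n :=
  Nat.sInf_le fun h => absurd h (lt_irrefl n)

theorem le_eflag {n b : ℕ} {x : ErdosSpace} (hb : b ≤ n)
    (h : ∀ i < b, ¬ Moves n i (co x i)) : b ≤ eflag n x := by
  refine le_csInf ⟨n, fun h => absurd h (lt_irrefl n)⟩ fun i hi => ?_
  by_contra! hib
  exact h i hib (hi (by omega))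

theorem not_moves_of_lt_eflag {n i : ℕ} {x : ErdosSpace} (h : i < eflag n x) :
    ¬ Moves n i (co x i) := fun h' => Nat.notMem_of_lt_sInf h fun _ => h'

/-- The integral weight of a point at a given level. -/
noncomputable def ebin (n : ℕ) (x : ErdosSpace) : ℕ := weight (code n (co x n) 0)

theorem abs_ebin_sub_le (x : ErdosSpace) (n : ℕ) :
    |(ebin n x : ℝ) / 2 ^ n - (co x n : ℝ) ^ 2| ≤ 3 / 2 ^ n := abs_weight_sub_le n _

theorem abs_sub_ebin_le (x : ErdosSpace) (n : ℕ) :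
    |(co x n : ℝ) ^ 2 - (ebin n x : ℝ) / 2 ^ n| ≤ 3 / 2 ^ n := by
  rw [abs_sub_comm]; exact abs_ebin_sub_le x n

theorem summable_ebin (x : ErdosSpace) : Summable fun n => (ebin n x : ℝ) / 2 ^ n :=
  summable_of_close (abs_sub_ebin_le x) (summable_co x)

/-- Two points have the same digits up to the `n`-th antidiagonal. -/
def SameDigits (n : ℕ) (x y : ErdosSpace) : Prop :=
  ∀ i < n, SameCode i (n - i) (co x i) (co y i)

/-- The equivalence relation of having the same digits. -/
def digitSetoid (n : ℕ) : Setoid ErdosSpace where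
  r := SameDigits n
  iseqv := ⟨fun _ _ _ _ _ => rfl, fun h i hi => (h i hi).symm,
    fun h h' i hi => (h i hi).trans (h' i hi)⟩

theorem countable_quotient_digitSetoid (n : ℕ) : Countable (Quotient (digitSetoid n)) := by
  refine Function.Injective.countable
    (f := fun (q : Quotient (digitSetoid n)) (i j : Fin n) => code i (co q.out i) j)
    fun q q' h => ?_
  rw [← q.out_eq, ← q'.out_eq]
  exact Quotient.sound fun i hi j hj => congrFun (congrFun h ⟨i, hi⟩) ⟨j, by omega⟩

theorem eflag_congr {n : ℕ} {x y : ErdosSpace} (h : SameDigits (n + 1) x y) :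
    eflag n x = eflag n y := by
  have : {i | i < n → Moves n i (co x i)} = {i | i < n → Moves n i (co y i)} := by
    ext i
    refine forall_congr' fun hi => moves_congr ?_
    have := h i (by omega)
    rwa [Nat.sub_add_comm hi.le] at this
  rw [eflag, eflag, this]

theorem tendsto_eflag (x : ErdosSpace) : Tendsto (fun n => eflag n x) atTop atTop := by
  refine tendsto_atTop.2 fun b => ?_
  have : ∀ᶠ n in atTop, ∀ i ∈ Iio b, ¬ Moves n i (co x i) :=
    (eventually_all_finite (finite_Iio b)).2 fun i _ => eventually_not_moves i _
  filter_upwards [this, eventually_ge_atTop b] with n h1 h2 using le_eflag h2 h1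

theorem exists_sameDigits (n : ℕ) (x : ErdosSpace) (ρ b c : ℕ) (hρ : ρ ≤ n) :
    ∃ y, (SameDigits n x y ∧ eflag n y = ρ ∧ ebin n y = b) ∧
      code n (co y n) 0 = Encodable.encode ((b : ℤ), c) := by
  have hrow : ∀ i, ∃ q, (i < n → SameCode i (n - i) (co x i) q) ∧
      (i < ρ → ¬ Moves n i q) ∧ (i = ρ → i < n → Moves n i q) ∧
      (i = n → code i q 0 = Encodable.encode ((b : ℤ), c)) ∧ (n < i → q = co x i) := by
    intro i
    rcases lt_trichotomy i n with hi | rfl | hi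
    · rcases eq_or_ne i ρ with hiρ | hiρ
      · obtain ⟨q, h1, h2⟩ := exists_moves n i (co x i)
        exact ⟨q, fun _ => h1, fun h => by omega, fun _ _ => h2, fun h => by omega,
          fun h => by omega⟩
      · obtain ⟨q, h1, h2⟩ := exists_not_moves n i (co x i)
        exact ⟨q, fun _ => h1, fun _ => h2, fun h => by omega, fun h => by omega,
          fun h => by omega⟩
    · obtain ⟨q, hq⟩ := exists_code_eq i 1 fun _ => Encodable.encode ((b : ℤ), c)
      exact ⟨q, fun h => by omega, fun h => by omega, fun _ h => by omega,
        fun _ => hq 0 one_pos, fun h => by omega⟩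
    · exact ⟨co x i, fun h => by omega, fun h => by omega, fun _ h => by omega,
        fun h => by omega, fun _ => rfl⟩
  choose q h1 h2 h3 h4 h5 using hrow
  obtain ⟨y, hy⟩ := exists_of_summable q (by
    refine (summable_nat_add_iff (n + 1)).1
      (((summable_nat_add_iff (n + 1)).2 (summable_co x)).congr fun m => ?_)
    rw [h5 _ (by omega)])
  have hcode : code n (co y n) 0 = Encodable.encode ((b : ℤ), c) := by rw [hy, h4 n rfl]
  refine ⟨y, ⟨fun i hi => by rw [hy]; exact h1 i hi, le_antisymm ?_ ?_, ?_⟩, hcode⟩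
  · refine Nat.sInf_le fun h => ?_
    rw [hy]
    exact h3 ρ rfl h
  · exact le_eflag hρ fun i hi => by rw [hy]; exact h2 i hi
  · rw [ebin, hcode, weight_encode]

theorem exists_limit {x : ℕ → ErdosSpace} (hx : ∀ n, SameDigits n (x n) (x (n + 1)))
    (hflag : Tendsto (fun n => eflag n (x (n + 1))) atTop atTop)
    (hbin : Summable fun n => (ebin n (x (n + 1)) : ℝ) / 2 ^ n) :
    ∃ z, ∀ n, SameDigits n z (x n) := by
  have hrow : ∀ i, ∃ q, ∀ k, SameCode i k q (co (x (i + k)) i) := by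
    intro i
    refine exists_same_limit (q := fun k => co (x (i + k)) i) (fun k => ?_) ?_
    · rcases Nat.eq_zero_or_pos k with rfl | hk
      · exact fun j hj => absurd hj j.not_lt_zero
      · have := hx (i + k) i (by omega)
        rwa [Nat.add_sub_cancel_left] at this
    · have := (tendsto_add_atTop_nat i).eventually (hflag.eventually_gt_atTop i)
      filter_upwards [this] with k hk
      have h := not_not.1 (not_moves_of_lt_eflag hk)
      rw [Nat.add_sub_cancel, show k + i + 1 = i + (k + 1) by omega] at h
      exact h
  choose q hq using hrow
  have hz : ∀ n, |(ebin n (x (n + 1)) : ℝ) / 2 ^ n - (q n : ℝ) ^ 2| ≤ 3 / 2 ^ n := fun n => by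
    rw [ebin, ← hq n 1 0 one_pos]
    exact abs_weight_sub_le n (q n)
  obtain ⟨z, hzq⟩ := exists_of_summable q (summable_of_close hz hbin)
  refine ⟨z, fun n i hi => ?_⟩
  have := hq i (n - i)
  rwa [Nat.add_sub_cancel' hi.le, ← hzq] at this

theorem eventually_sameDigits_iff {x : ErdosSpace} {l : Filter ErdosSpace} :
    (∀ n, ∀ᶠ y in l, SameDigits n x y) ↔
      ∀ n, Tendsto (fun y => (co y n : ℝ)) l (𝓝 (co x n)) := by
  constructor
  · intro h i
    rw [Metric.tendsto_nhds]
    intro ε hε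
    obtain ⟨k, hk⟩ := exists_code_separates i hε
    filter_upwards [h (i + k + 1)] with y hy
    exact hk _ _ ((hy i (by omega)).mono (by omega))
  · intro h n
    have : ∀ᶠ y in l, ∀ i ∈ Iio n, SameCode i (n - i) (co x i) (co y i) :=
      (eventually_all_finite (finite_Iio n)).2 fun i _ =>
        ((h i).eventually (code_locally_constant i (n - i) (co x i))).mono fun y hy => hy _ rfl
    exact this

/-- Erdős space carries an `ErdosStructure`. -/
noncomputable def erdosStructure : ErdosStructure ErdosSpace where
  rel := digitSetoid
  flag := eflag
  bin := ebin
  rel_zero _ _ i hi := absurd hi i.not_lt_zero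
  rel_mono n _ _ h i hi := (h i (by omega)).mono (by omega)
  countable_quotient := countable_quotient_digitSetoid
  flag_le := eflag_le
  flag_congr _ _ _ h := eflag_congr h
  bin_congr n x y h := by rw [ebin, ebin, h n n.lt_succ_self 0 (by omega)]
  full n x ρ b hρ := by
    choose y hy hc using fun c => exists_sameDigits n x ρ b c hρ
    refine ⟨y, hy, fun c c' h => ?_⟩
    have h1 := h n n.lt_succ_self 0 (by omega)
    rw [hc, hc] at h1
    simpa using Encodable.encode_injective h1
  flag_tendsto := tendsto_eflag
  bin_summable := summable_ebin
  eq_of_rel x y h := ext_co fun i => eq_of_code_eq (i := i) fun j =>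
    h (i + j + 1) i (by omega) j (by omega)
  complete _ h1 h2 h3 := exists_limit h1 h2 h3
  le_nhds_iff x l := by
    rw [le_nhds_iff_co, ← eventually_sameDigits_iff]
    exact and_congr_right fun _ =>
      ⟨fun h => h.of_close (fun _ _ => sq_nonneg _) summable_co abs_sub_ebin_le,
        fun h => h.of_close (fun _ _ => by positivity) summable_ebin abs_ebin_sub_le⟩

end ErdosSpace

/-! ### Homogeneity -/

namespace FinHyp

variable {X Y : Type*}

/-- The image of a finite set under a map. -/
def map (f : X → Y) (F : FinHyp X) : FinHyp Y :=
  ofSet (f '' {x | x ∈ F}) (F.finite.image f) (F.nonempty.image f)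

theorem map_map_of_leftInverse {f : X → Y} {g : Y → X} (h : Function.LeftInverse g f)
    (F : FinHyp X) : (F.map f).map g = F := by
  refine ext fun x => ⟨?_, fun hx => ⟨f x, ⟨x, hx, rfl⟩, h x⟩⟩
  rintro ⟨_, ⟨y, hy, rfl⟩, rfl⟩
  rw [h]
  exact hy

theorem continuous_map [TopologicalSpace X] [TopologicalSpace Y] {f : X → Y}
    (hf : Continuous f) : Continuous (map f) := by
  refine continuous_iff_continuousAt.2 fun F => le_nhds_iff.2 ?_
  obtain ⟨h1, h2⟩ := le_nhds_iff.1 (le_refl (𝓝 F))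
  refine ⟨fun U hU hF => ?_, fun U hU hF => ?_⟩
  · refine eventually_map.2 ((h1 _ (hU.preimage hf) fun y hy => hF _ ⟨y, hy, rfl⟩).mono ?_)
    rintro G hG _ ⟨y, hy, rfl⟩
    exact hG y hy
  · obtain ⟨_, ⟨y, hy, rfl⟩, hyU⟩ := hF
    refine eventually_map.2 ((h2 _ (hU.preimage hf) ⟨y, hy, hyU⟩).mono ?_)
    rintro G ⟨z, hz, hzU⟩
    exact ⟨f z, ⟨z, hz, rfl⟩, hzU⟩

/-- A homeomorphism of spaces induces a homeomorphism of their finite hyperspaces. -/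
def mapHomeomorph [TopologicalSpace X] [TopologicalSpace Y] (e : X ≃ₜ Y) :
    FinHyp X ≃ₜ FinHyp Y where
  toFun := map e
  invFun := map e.symm
  left_inv := map_map_of_leftInverse e.symm_apply_apply
  right_inv := map_map_of_leftInverse e.apply_symm_apply
  continuous_toFun := continuous_map e.continuous
  continuous_invFun := continuous_map e.symm.continuous

instance [Nonempty X] : Nonempty (FinHyp X) :=
  ⟨ofSet {Classical.arbitrary X} (finite_singleton _) (singleton_nonempty _)⟩

end FinHyp

instance : Nonempty ErdosSpace := ⟨⟨0, fun _ => ⟨0, by simp⟩⟩⟩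

theorem ErdosSpace.exists_homeomorph_eq (x y : ErdosSpace) :
    ∃ t : ErdosSpace ≃ₜ ErdosSpace, t x = y := by
  refine ⟨(Homeomorph.addRight (y.1 - x.1)).subtype fun z => forall_congr' fun n => ?_,
    Subtype.ext (add_sub_cancel x.1 y.1)⟩
  obtain ⟨p, hp⟩ := x.2 n
  obtain ⟨q, hq⟩ := y.2 n
  have h : (z + (y.1 - x.1)) n = z n + (q - p) := by
    rw [lp.coeFn_add, Pi.add_apply, lp.coeFn_sub, Pi.sub_apply, hp, hq]
  change (∃ r : ℚ, z n = r) ↔ ∃ r : ℚ, (z + (y.1 - x.1)) n = r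
  rw [h]
  constructor
  · rintro ⟨r, hr⟩
    exact ⟨r + (q - p), by rw [hr]; push_cast; ring⟩
  · rintro ⟨r, hr⟩
    exact ⟨r - (q - p), by push_cast; linarith⟩

/-- Erdős space is homeomorphic to its finite hyperspace. -/
theorem nonempty_finHyp_erdosSpace_homeomorph : Nonempty (FinHyp ErdosSpace ≃ₜ ErdosSpace) := by
  obtain ⟨e⟩ := ErdosSpace.erdosStructure.nonempty_homeomorph
  have : Nonempty ErdosModel := ⟨e (Classical.arbitrary _)⟩
  obtain ⟨k⟩ := ErdosModel.finHypStructure.nonempty_homeomorph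
  exact ⟨(FinHyp.mapHomeomorph e).trans (k.trans e.symm)⟩

/-- The Vietoris hyperspace `ℱ(𝔈)` of nonempty finite subsets of Erdős space is
homogeneous: any point can be mapped to any other point by a self-homeomorphism. -/
theorem finHyp_erdosSpace_homogeneous (F G : FinHyp ErdosSpace) :
    ∃ h : FinHyp ErdosSpace ≃ₜ FinHyp ErdosSpace, h F = G := by
  obtain ⟨e⟩ := nonempty_finHyp_erdosSpace_homeomorph
  obtain ⟨t, ht⟩ := ErdosSpace.exists_homeomorph_eq (e F) (e G)
  exact ⟨e.trans (t.trans e.symm), by simp [ht]⟩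
end

section
/- For every n ∈ ℕ (n ≥ 1), the Vietoris hyperspace ℱₙ(ℚ^ω) of nonempty subsets of ℚ^ω of cardinality at most n is homeomorphic to ℚ^ω. -/
open Set Topology Filter

/-- `ℱₙ(X)`: the hyperspace of nonempty subsets of `X` of cardinality at most `n`. -/
def FinHypN (n : ℕ) (X : Type*) : Type _ := {F : Set X // F.Nonempty ∧ F.encard ≤ n}

noncomputable instance FinHypN.instCoeOut {n : ℕ} {X : Type*} : CoeOut (FinHypN n X) (Set X) :=
  ⟨Subtype.val⟩

/-- `ℱₙ(X)` carries the (subspace) Vietoris topology. -/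
instance FinHypN.instTopologicalSpace {n : ℕ} {X : Type*} [t : TopologicalSpace X] :
    TopologicalSpace (FinHypN n X) :=
  (vietoris t).induced Subtype.val


/-- A sequence `δ` of clopen partitions generating the topology of `X`, together with a refining
sequence `p` of countable partitions into closed sets such that every cell of `p (k + 1)` is
nowhere dense in the cell of `p k` containing it, and such that a sequence which eventually stays
in a single cell of each `p k` converges. -/
structure IsStratification {X : Type*} [TopologicalSpace X] (δ p : ℕ → X → ℕ) : Prop where
  isLocallyConstant : ∀ m, IsLocallyConstant (δ m)
  exists_cell_subset : ∀ x, ∀ U ∈ 𝓝 x, ∃ m, ∀ y, δ m y = δ m x → y ∈ U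
  refines : ∀ m x y, δ (m + 1) x = δ (m + 1) y → δ m x = δ m y
  stratum_refines : ∀ k x y, p (k + 1) x = p (k + 1) y → p k x = p k y
  stratum_zero : ∀ x y, p 0 x = p 0 y
  isClosed_stratum : ∀ k x, IsClosed {y | p k y = p k x}
  exists_near : ∀ k x, ∀ U ∈ 𝓝 x, ∃ y ∈ U, p k y = p k x ∧ p (k + 1) y ≠ p (k + 1) x
  exists_lim : ∀ a : ℕ → X, (∀ k, ∃ N, ∀ n ≥ N, p k (a n) = p k (a N)) →
    ∃ x, Tendsto a atTop (𝓝 x)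

namespace IsStratification

variable {X : Type*} [TopologicalSpace X] {δ p : ℕ → X → ℕ}

theorem refines_of_le (S : IsStratification δ p) {m n : ℕ} (h : m ≤ n) {x y : X}
    (hxy : δ n x = δ n y) : δ m x = δ m y := by
  induction n, h using Nat.le_induction with
  | base => exact hxy
  | succ n _ ih => exact ih (S.refines n x y hxy)

theorem stratum_refines_of_le (S : IsStratification δ p) {m n : ℕ} (h : m ≤ n) {x y : X}
    (hxy : p n x = p n y) : p m x = p m y := by
  induction n, h using Nat.le_induction with
  | base => exact hxy
  | succ n _ ih => exact ih (S.stratum_refines n x y hxy)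

/-- Every neighbourhood assignment is refined by a countable clopen partition. -/
theorem exists_partition (S : IsStratification δ p) (N : X → Set X) (hN : ∀ x, N x ∈ 𝓝 x) :
    ∃ f : X → ℕ, IsLocallyConstant f ∧ ∀ x, ∃ z, ∀ y, f y = f x → y ∈ N z := by
  classical
  have hex : ∀ x, ∃ m, ∃ z, ∀ y, δ m y = δ m x → y ∈ N z := fun x =>
    let ⟨m, hm⟩ := S.exists_cell_subset x (N x) (hN x)
    ⟨m, x, hm⟩
  have hfind : ∀ x y, δ (Nat.find (hex x)) y = δ (Nat.find (hex x)) x →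
      Nat.find (hex y) = Nat.find (hex x) := by
    intro x y hxy
    rw [Nat.find_eq_iff]
    refine ⟨by simpa only [hxy] using Nat.find_spec (hex x), fun k hk => ?_⟩
    have := Nat.find_min (hex x) hk
    rwa [← S.refines_of_le hk.le hxy] at this
  refine ⟨fun x => Nat.pair (Nat.find (hex x)) (δ (Nat.find (hex x)) x), ?_, fun x => ?_⟩
  · rw [IsLocallyConstant.iff_eventually_eq]
    intro x
    filter_upwards [(S.isLocallyConstant (Nat.find (hex x))).eventually_eq x] with y hy
    rw [hfind x y hy, hy]
  · obtain ⟨z, hz⟩ := Nat.find_spec (hex x)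
    refine ⟨z, fun y hy => hz y ?_⟩
    rw [Nat.pair_eq_pair] at hy
    rw [← hy.2, hy.1]

theorem isClosed_fiber (S : IsStratification δ p) (k c : ℕ) : IsClosed {y | p k y = c} := by
  by_cases h : ∃ x, p k x = c
  · obtain ⟨x, rfl⟩ := h
    exact S.isClosed_stratum k x
  · push Not at h
    simp [h]

theorem not_isCompact (S : IsStratification δ p) [T2Space X] {U : Set X} (hU : IsClopen U)
    {a : X} (ha : a ∈ U) (h : ℕ) : ¬ IsCompact (U ∩ {y | p h y = p h a}) := by
  intro hK
  set K := U ∩ {y | p h y = p h a} with hKdef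
  have : CompactSpace K := isCompact_iff_compactSpace.1 hK
  have : Nonempty K := ⟨⟨a, ha, rfl⟩⟩
  obtain ⟨c, ⟨x, hxK⟩, hx⟩ := nonempty_interior_of_iUnion_of_closed
    (f := fun c : ℕ => {y : K | p (h + 1) y = c})
    (fun c => (S.isClosed_fiber (h + 1) c).preimage continuous_subtype_val)
    (by ext y; simp)
  have hxc : (⟨x, hxK⟩ : K) ∈ {y : K | p (h + 1) y = c} := interior_subset hx
  obtain ⟨V, hV, hVsub⟩ := mem_nhds_subtype _ _ _ |>.1 (mem_interior_iff_mem_nhds.1 hx)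
  obtain ⟨y, hy, hy1, hy2⟩ := S.exists_near h x (V ∩ U)
    (inter_mem hV (hU.isOpen.mem_nhds hxK.1))
  have hyK : y ∈ K := ⟨hy.2, hy1.trans hxK.2⟩
  have hyc : (⟨y, hyK⟩ : K) ∈ {y : K | p (h + 1) y = c} := hVsub hy.1
  exact hy2 (hyc.trans hxc.symm)

theorem exists_infinite_image (S : IsStratification δ p) [T2Space X] {U : Set X}
    (hU : IsClopen U) {a : X} (ha : a ∈ U) (h : ℕ) :
    ∃ g : X → ℕ, IsLocallyConstant g ∧ (g '' (U ∩ {y | p h y = p h a})).Infinite := by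
  classical
  set K := U ∩ {y | p h y = p h a} with hKdef
  have hKc : IsClosed K := hU.isClosed.inter (S.isClosed_stratum h a)
  have hK := S.not_isCompact hU ha h
  rw [isCompact_iff_finite_subcover] at hK
  push Not at hK
  obtain ⟨ι, V, hVo, hKV, hfin⟩ := hK
  have hN : ∀ x, ∃ N ∈ 𝓝 x, ∃ t : Finset ι, N ∩ K ⊆ ⋃ i ∈ t, V i := by
    intro x
    by_cases hx : x ∈ K
    · obtain ⟨i, hi⟩ := mem_iUnion.1 (hKV hx)
      exact ⟨V i, (hVo i).mem_nhds hi, {i}, by simp⟩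
    · exact ⟨Kᶜ, hKc.isOpen_compl.mem_nhds hx, ∅, by simp⟩
  choose N hN t ht using hN
  obtain ⟨g, hg, hgN⟩ := S.exists_partition N hN
  refine ⟨g, hg, fun hgK => ?_⟩
  choose z hz using hgN
  obtain ⟨F, hFK, hF⟩ := exists_subset_bijOn K g
  have hFfin : F.Finite := Set.Finite.of_finite_image (hF.image_eq ▸ hgK) hF.injOn
  refine hfin (hFfin.toFinset.biUnion fun x => t (z x)) fun y hy => ?_
  obtain ⟨x, hxF, hxy⟩ := hF.surjOn (mem_image_of_mem g hy)
  have := ht (z x) ⟨hz x y hxy.symm, hy⟩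
  simp only [mem_iUnion] at this ⊢
  obtain ⟨i, hi, hyi⟩ := this
  exact ⟨i, Finset.mem_biUnion.2 ⟨x, by simpa using hxF, hi⟩, hyi⟩

/-- A clopen set `U` splits into small clopen pieces indexed by pairs `(j, i)` with `j ≤ h`, where
`j` is the last level at which the piece meets the stratum of `a`. -/
theorem exists_split (S : IsStratification δ p) [T2Space X] {U : Set X} (hU : IsClopen U) {a : X}
    (ha : a ∈ U) (h n : ℕ) :
    ∃ φ : X → ℕ × ℕ, IsLocallyConstant φ ∧ (∀ x, (φ x).1 ≤ h) ∧
      (∀ j ≤ h, ∀ i, ∃ y ∈ U, φ y = (j, i) ∧ p j y = p j a) ∧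
      (∀ y ∈ U, (φ y).1 < h → p ((φ y).1 + 1) y ≠ p ((φ y).1 + 1) a) ∧
      (∀ x ∈ U, ∀ y ∈ U, φ x = φ y → δ n x = δ n y) := by
  classical
  obtain ⟨g, hg, hginf⟩ := S.exists_infinite_image hU ha h
  have hd : ∀ v j, ∃ d : X, v ∈ g '' (U ∩ {y | p h y = p h a}) → j ≤ h →
      d ∈ U ∧ g d = v ∧ p j d = p j a ∧ (j < h → p (j + 1) d ≠ p (j + 1) a) := by
    intro v j
    by_cases hv : v ∈ g '' (U ∩ {y | p h y = p h a})
    · obtain ⟨y, ⟨hyU, hy⟩, rfl⟩ := hv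
      rcases lt_or_ge j h with hj | hj
      · obtain ⟨d, hd, hd1, hd2⟩ := S.exists_near j y (U ∩ {x | g x = g y})
          (inter_mem (hU.isOpen.mem_nhds hyU) (hg.eventually_eq y))
        refine ⟨d, fun _ _ => ⟨hd.1, hd.2, hd1.trans (S.stratum_refines_of_le hj.le hy),
          fun _ => ?_⟩⟩
        rwa [← S.stratum_refines_of_le (Nat.succ_le_of_lt hj) hy]
      · exact ⟨y, fun _ hj' => ⟨hyU, rfl, S.stratum_refines_of_le hj' hy,
          fun hlt => absurd hlt (not_lt.2 hj)⟩⟩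
    · exact ⟨a, fun hv' => absurd hv' hv⟩
  choose d hd using hd
  obtain ⟨f, hf, hfN⟩ := S.exists_partition
    (fun x => {y | (y ∈ U ↔ x ∈ U) ∧ δ n y = δ n x ∧ g y = g x ∧
      (∀ j ∈ Finset.range (h + 1), p j x ≠ p j a → p j y ≠ p j a) ∧
      (∀ j ∈ Finset.range (h + 1), d (g x) j ≠ x → y ≠ d (g x) j)}) (by
    intro x
    have h1 : ∀ᶠ y in 𝓝 x, (y ∈ U ↔ x ∈ U) := by
      by_cases hx : x ∈ U
      · filter_upwards [hU.isOpen.mem_nhds hx] with y hy using by simp [hx, hy]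
      · filter_upwards [hU.compl.isOpen.mem_nhds hx] with y hy using by simpa [hx] using hy
    refine h1.and (((S.isLocallyConstant n).eventually_eq x).and ((hg.eventually_eq x).and
      (Eventually.and ?_ ?_)))
    · rw [Finset.eventually_all]
      intro j _
      by_cases hx : p j x = p j a
      · simp [hx]
      · filter_upwards [(S.isClosed_stratum j a).isOpen_compl.mem_nhds hx] with y hy _ using hy
    · rw [Finset.eventually_all]
      intro j _
      by_cases hx : d (g x) j = x
      · simp [hx]
      · filter_upwards [isOpen_compl_singleton.mem_nhds (Ne.symm hx)] with y hy _ using hy)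
  have hfN' : ∀ x y, f x = f y → δ n x = δ n y ∧ g x = g y ∧ (x ∈ U ↔ y ∈ U) := by
    intro x y hxy
    obtain ⟨z, hz⟩ := hfN y
    obtain ⟨x1, x2, x3, -⟩ := hz x hxy
    obtain ⟨y1, y2, y3, -⟩ := hz y rfl
    exact ⟨x2.trans y2.symm, x3.trans y3.symm, x1.trans y1.symm⟩
  have hfd : ∀ v ∈ g '' (U ∩ {y | p h y = p h a}), ∀ j ≤ h, ∀ y, f y = f (d v j) →
      ∀ k ≤ h, p k (d v j) ≠ p k a → p k y ≠ p k a := by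
    intro v hv j hj y hy k hk hkd
    obtain ⟨z, hz⟩ := hfN (d v j)
    obtain ⟨-, -, z3, -, z5⟩ := hz (d v j) rfl
    have hzv : g z = v := z3.symm.trans (hd v j hv hj).2.1
    have hzd : z = d v j := by
      by_contra hne
      have := z5 j (Finset.mem_range.2 (Nat.lt_succ_of_le hj))
      rw [hzv] at this
      exact this (Ne.symm hne) rfl
    subst hzd
    exact (hz y hy).2.2.2.1 k (Finset.mem_range.2 (Nat.lt_succ_of_le hk)) hkd
  let τ : ℕ → ℕ := fun v => Nat.findGreatest (fun j => ∃ y ∈ U, f y = v ∧ p j y = p j a) h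
  let Q : ℕ → ℕ → Prop := fun j v => v ∈ f '' U ∧ τ v = j
  have hτd : ∀ v ∈ g '' (U ∩ {y | p h y = p h a}), ∀ j ≤ h, Q j (f (d v j)) := by
    intro v hv j hj
    obtain ⟨d1, d2, d3, d4⟩ := hd v j hv hj
    refine ⟨mem_image_of_mem f d1, ?_⟩
    refine le_antisymm ?_ (Nat.le_findGreatest hj ⟨_, d1, rfl, d3⟩)
    by_contra! hlt
    obtain ⟨y, -, hy, hya⟩ := Nat.findGreatest_of_ne_zero (P := fun j' => ∃ y ∈ U,
      f y = f (d v j) ∧ p j' y = p j' a) (n := h) rfl (Nat.ne_zero_of_lt hlt)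
    have hle : τ (f (d v j)) ≤ h := Nat.findGreatest_le h
    refine hfd v hv j hj y hy (j + 1) (hlt.trans_le hle) (d4 (hlt.trans_le hle)) ?_
    exact S.stratum_refines_of_le hlt hya
  have hQinf : ∀ j ≤ h, {v | Q j v}.Infinite := by
    intro j hj
    refine (hginf.image (f := fun v => f (d v j)) ?_).mono ?_
    · intro v hv w hw hvw
      have := (hfN' _ _ hvw).2.1
      rwa [(hd v j hv hj).2.1, (hd w j hw hj).2.1] at this
    · rintro _ ⟨v, hv, rfl⟩
      exact hτd v hv j hj
  refine ⟨fun x => (τ (f x), Nat.count (Q (τ (f x))) (f x)),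
    hf.comp fun v => (τ v, Nat.count (Q (τ v)) v), fun x => Nat.findGreatest_le h, ?_, ?_, ?_⟩
  · intro j hj i
    have hmem : Q j (Nat.nth (Q j) i) := Nat.nth_mem_of_infinite (hQinf j hj) i
    obtain ⟨⟨y', hy'U, hy'⟩, hτ⟩ := hmem
    obtain ⟨y, hyU, hy, hya⟩ : ∃ y ∈ U, f y = Nat.nth (Q j) i ∧ p j y = p j a := by
      have := Nat.findGreatest_spec (P := fun j' => ∃ y ∈ U,
        f y = Nat.nth (Q j) i ∧ p j' y = p j' a) (n := h) (Nat.zero_le h)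
        ⟨y', hy'U, hy', S.stratum_zero _ _⟩
      change ∃ y ∈ U, f y = Nat.nth (Q j) i ∧ p (τ (Nat.nth (Q j) i)) y =
        p (τ (Nat.nth (Q j) i)) a at this
      rwa [hτ] at this
    refine ⟨y, hyU, ?_, hya⟩
    simp only [hy, hτ, Nat.count_nth_of_infinite (hQinf j hj)]
  · intro y hyU hlt heq
    exact Nat.findGreatest_is_greatest (Nat.lt_succ_self _) hlt ⟨y, hyU, rfl, heq⟩
  · intro x hx y hy hxy
    simp only [Prod.mk.injEq] at hxy
    obtain ⟨h1, h2⟩ := hxy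
    rw [h1] at h2
    exact (hfN' x y (Nat.count_injective ⟨mem_image_of_mem f hx, h1⟩
      ⟨mem_image_of_mem f hy, rfl⟩ h2)).1

end IsStratification

/-- A stage of the coding: a clopen set together with a level and a point, which selects a stratum
of that level meeting the clopen set. -/
structure StratumPiece (X : Type*) [TopologicalSpace X] where
  carrier : Set X
  height : ℕ
  point : X
  isClopen : IsClopen carrier
  mem : point ∈ carrier

/-- The whole space as a piece of height `0`. -/
def StratumPiece.whole {X : Type*} [TopologicalSpace X] (x : X) : StratumPiece X :=
  ⟨univ, 0, x, isClopen_univ, mem_univ x⟩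

/-- A rule splitting every piece, at every time `n`, into infinitely many smaller ones of all
heights at most one more than its own. -/
structure StratumSplitting {X : Type*} [TopologicalSpace X] (δ p : ℕ → X → ℕ) where
  anchor : ℕ → StratumPiece X → X
  code : ℕ → StratumPiece X → X → ℕ × ℕ
  next : ℕ → StratumPiece X → ℕ × ℕ → StratumPiece X
  anchor_mem : ∀ n s, anchor n s ∈ s.carrier
  anchor_stratum : ∀ n s, p s.height (anchor n s) = p s.height s.point
  anchor_minimal : ∀ n s, ∀ y ∈ s.carrier, p s.height y = p s.height s.point →
    p (s.height + 1) (anchor n s) ≤ p (s.height + 1) y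
  isLocallyConstant_code : ∀ n s, IsLocallyConstant (code n s)
  code_le : ∀ n s x, (code n s x).1 ≤ s.height + 1
  code_avoids : ∀ n s, ∀ y ∈ s.carrier, (code n s y).1 ≤ s.height →
    p ((code n s y).1 + 1) y ≠ p ((code n s y).1 + 1) (anchor n s)
  code_fine : ∀ n s, ∀ x ∈ s.carrier, ∀ y ∈ s.carrier, code n s x = code n s y → δ n x = δ n y
  next_carrier : ∀ n s c, c.1 ≤ s.height + 1 →
    (next n s c).carrier = s.carrier ∩ {y | code n s y = c}
  next_height : ∀ n s c, c.1 ≤ s.height + 1 → (next n s c).height = c.1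
  next_point : ∀ n s c, c.1 ≤ s.height + 1 → p c.1 (next n s c).point = p c.1 (anchor n s)

theorem IsStratification.nonempty_splitting {X : Type*} [TopologicalSpace X] [T2Space X]
    {δ p : ℕ → X → ℕ} (S : IsStratification δ p) : Nonempty (StratumSplitting δ p) := by
  classical
  have key : ∀ (n : ℕ) (s : StratumPiece X), ∃ (a : X) (φ : X → ℕ × ℕ)
      (next : ℕ × ℕ → StratumPiece X),
      a ∈ s.carrier ∧ p s.height a = p s.height s.point ∧
      (∀ y ∈ s.carrier, p s.height y = p s.height s.point →
        p (s.height + 1) a ≤ p (s.height + 1) y) ∧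
      IsLocallyConstant φ ∧ (∀ x, (φ x).1 ≤ s.height + 1) ∧
      (∀ y ∈ s.carrier, (φ y).1 ≤ s.height → p ((φ y).1 + 1) y ≠ p ((φ y).1 + 1) a) ∧
      (∀ x ∈ s.carrier, ∀ y ∈ s.carrier, φ x = φ y → δ n x = δ n y) ∧
      (∀ c : ℕ × ℕ, c.1 ≤ s.height + 1 →
        (next c).carrier = s.carrier ∩ {y | φ y = c}) ∧
      (∀ c : ℕ × ℕ, c.1 ≤ s.height + 1 → (next c).height = c.1) ∧
      (∀ c : ℕ × ℕ, c.1 ≤ s.height + 1 → p c.1 (next c).point = p c.1 a) := by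
    intro n s
    obtain ⟨a, ⟨haU, ha⟩, hmin⟩ : ∃ a ∈ s.carrier ∩ {y | p s.height y = p s.height s.point},
        ∀ y ∈ s.carrier ∩ {y | p s.height y = p s.height s.point},
          p (s.height + 1) a ≤ p (s.height + 1) y := by
      have hne : (s.carrier ∩ {y | p s.height y = p s.height s.point}).Nonempty :=
        ⟨s.point, s.mem, rfl⟩
      refine ⟨Function.argminOn (p (s.height + 1)) _ hne, Function.argminOn_mem _ _ hne,
        fun y hy => Function.argminOn_le _ _ hy⟩
    obtain ⟨φ, h1, h2, h3, h4, h5⟩ := S.exists_split s.isClopen haU (s.height + 1) n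
    have hnext : ∀ c : ℕ × ℕ, ∃ t : StratumPiece X, c.1 ≤ s.height + 1 →
        t.carrier = s.carrier ∩ {y | φ y = c} ∧ t.height = c.1 ∧ p c.1 t.point = p c.1 a := by
      intro c
      by_cases hc : c.1 ≤ s.height + 1
      · obtain ⟨y, hyU, hyc, hya⟩ := h3 c.1 hc c.2
        exact ⟨⟨s.carrier ∩ {y | φ y = c}, c.1, y, s.isClopen.inter (h1.isClopen_fiber c),
          hyU, hyc⟩, fun _ => ⟨rfl, rfl, hya⟩⟩
      · exact ⟨s, fun h => absurd h hc⟩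
    choose next hnext using hnext
    exact ⟨a, φ, next, haU, ha, fun y hy hy' => hmin y ⟨hy, hy'⟩, h1, h2,
      fun y hy hle => h4 y hy (Nat.lt_succ_of_le hle), h5, fun c hc => (hnext c hc).1,
      fun c hc => (hnext c hc).2.1, fun c hc => (hnext c hc).2.2⟩
  choose anchor code next h using key
  exact ⟨⟨anchor, code, next,
    fun n s => (h n s).1,
    fun n s => (h n s).2.1,
    fun n s => (h n s).2.2.1,
    fun n s => (h n s).2.2.2.1,
    fun n s => (h n s).2.2.2.2.1,
    fun n s => (h n s).2.2.2.2.2.1,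
    fun n s => (h n s).2.2.2.2.2.2.1,
    fun n s => (h n s).2.2.2.2.2.2.2.1,
    fun n s => (h n s).2.2.2.2.2.2.2.2.1,
    fun n s => (h n s).2.2.2.2.2.2.2.2.2⟩⟩

/-- The height reached by a code before time `n`. -/
def codeHeight (w : ℕ → ℕ × ℕ) : ℕ → ℕ
  | 0 => 0
  | n + 1 => (w n).1

/-- The universal code space: heights grow by at most one at each step and tend to infinity. -/
def codeSpace : Set (ℕ → ℕ × ℕ) :=
  {w | (∀ n, (w n).1 ≤ codeHeight w n + 1) ∧ Tendsto (codeHeight w) atTop atTop}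

namespace StratumSplitting

variable {X : Type*} [TopologicalSpace X] {δ p : ℕ → X → ℕ}

/-- The piece containing `x` at time `n`. -/
def piece (R : StratumSplitting δ p) (o x : X) : ℕ → StratumPiece X
  | 0 => StratumPiece.whole o
  | n + 1 => R.next n (R.piece o x n) (R.code n (R.piece o x n) x)

/-- The piece with a given code at time `n`. -/
def pieceOfCode (R : StratumSplitting δ p) (o : X) (w : ℕ → ℕ × ℕ) : ℕ → StratumPiece X
  | 0 => StratumPiece.whole o
  | n + 1 => R.next n (R.pieceOfCode o w n) (w n)

/-- The code of a point. -/
def encode (R : StratumSplitting δ p) (o x : X) (n : ℕ) : ℕ × ℕ := R.code n (R.piece o x n) x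

theorem mem_piece (R : StratumSplitting δ p) (o x : X) (n : ℕ) :
    x ∈ (R.piece o x n).carrier := by
  induction n with
  | zero => exact mem_univ x
  | succ n ih =>
    rw [piece, R.next_carrier _ _ _ (R.code_le _ _ _)]
    exact ⟨ih, rfl⟩

theorem piece_eq_pieceOfCode (R : StratumSplitting δ p) (o x : X) (n : ℕ) :
    R.piece o x n = R.pieceOfCode o (R.encode o x) n := by
  induction n with
  | zero => rfl
  | succ n ih => rw [piece, pieceOfCode, ← ih, encode]

theorem pieceOfCode_congr (R : StratumSplitting δ p) (o : X) {w w' : ℕ → ℕ × ℕ} {n : ℕ}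
    (h : ∀ i < n, w i = w' i) : R.pieceOfCode o w n = R.pieceOfCode o w' n := by
  induction n with
  | zero => rfl
  | succ n ih =>
    rw [pieceOfCode, pieceOfCode, ih fun i hi => h i (hi.trans n.lt_succ_self),
      h n n.lt_succ_self]

theorem pieceOfCode_height (R : StratumSplitting δ p) (o : X) {w : ℕ → ℕ × ℕ}
    (hw : ∀ n, (w n).1 ≤ codeHeight w n + 1) (n : ℕ) :
    (R.pieceOfCode o w n).height = codeHeight w n := by
  induction n with
  | zero => rfl
  | succ n ih => exact R.next_height _ _ _ (ih ▸ hw n)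

theorem pieceOfCode_carrier_succ (R : StratumSplitting δ p) (o : X) {w : ℕ → ℕ × ℕ}
    (hw : ∀ n, (w n).1 ≤ codeHeight w n + 1) (n : ℕ) :
    (R.pieceOfCode o w (n + 1)).carrier = (R.pieceOfCode o w n).carrier ∩
      {y | R.code n (R.pieceOfCode o w n) y = w n} :=
  R.next_carrier _ _ _ (R.pieceOfCode_height o hw n ▸ hw n)

theorem antitone_carrier (R : StratumSplitting δ p) (o : X) {w : ℕ → ℕ × ℕ}
    (hw : ∀ n, (w n).1 ≤ codeHeight w n + 1) :
    Antitone fun n => (R.pieceOfCode o w n).carrier :=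
  antitone_nat_of_succ_le fun n => by
    rw [R.pieceOfCode_carrier_succ o hw]
    exact inter_subset_left

theorem anchor_pieceOfCode (S : IsStratification δ p) (R : StratumSplitting δ p) (o : X)
    {w : ℕ → ℕ × ℕ} (hw : ∀ n, (w n).1 ≤ codeHeight w n + 1) {n k : ℕ}
    (hk : k ≤ codeHeight w n) :
    p k (R.anchor n (R.pieceOfCode o w n)) = p k (R.pieceOfCode o w n).point :=
  S.stratum_refines_of_le (hk.trans_eq (R.pieceOfCode_height o hw n).symm)
    (R.anchor_stratum n _)

theorem point_succ (S : IsStratification δ p) (R : StratumSplitting δ p) (o : X)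
    {w : ℕ → ℕ × ℕ} (hw : ∀ n, (w n).1 ≤ codeHeight w n + 1) {n k : ℕ}
    (hk : k ≤ codeHeight w (n + 1)) :
    p k (R.pieceOfCode o w (n + 1)).point = p k (R.anchor n (R.pieceOfCode o w n)) :=
  S.stratum_refines_of_le hk (R.next_point _ _ _ (R.pieceOfCode_height o hw n ▸ hw n))

theorem point_eq_of_le (S : IsStratification δ p) (R : StratumSplitting δ p) (o : X)
    {w : ℕ → ℕ × ℕ} (hw : ∀ n, (w n).1 ≤ codeHeight w n + 1) {k N : ℕ}
    (hk : ∀ n ≥ N, k ≤ codeHeight w n) {n : ℕ} (hn : N ≤ n) :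
    p k (R.pieceOfCode o w n).point = p k (R.pieceOfCode o w N).point := by
  induction n, hn using Nat.le_induction with
  | base => rfl
  | succ n hn ih =>
    rw [point_succ S R o hw (hk _ (hn.trans n.le_succ)), anchor_pieceOfCode S R o hw (hk n hn), ih]

theorem encode_le (R : StratumSplitting δ p) (o x : X) (n : ℕ) :
    (R.encode o x n).1 ≤ codeHeight (R.encode o x) n + 1 := by
  have hh : (R.piece o x n).height = codeHeight (R.encode o x) n := by
    cases n with
    | zero => rfl
    | succ n => exact R.next_height _ _ _ (R.code_le _ _ _)
  exact hh ▸ R.code_le _ _ _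

theorem mem_pieceOfCode_encode (R : StratumSplitting δ p) (o x : X) (n : ℕ) :
    x ∈ (R.pieceOfCode o (R.encode o x) n).carrier :=
  R.piece_eq_pieceOfCode o x n ▸ R.mem_piece o x n

theorem cell_eq_of_mem (R : StratumSplitting δ p) (o : X) {w : ℕ → ℕ × ℕ}
    (hw : ∀ n, (w n).1 ≤ codeHeight w n + 1) {m : ℕ} {x y : X}
    (hx : x ∈ (R.pieceOfCode o w (m + 1)).carrier)
    (hy : y ∈ (R.pieceOfCode o w (m + 1)).carrier) : δ m x = δ m y := by
  rw [R.pieceOfCode_carrier_succ o hw] at hx hy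
  exact R.code_fine m _ x hx.1 y hy.1 (hx.2.trans hy.2.symm)

theorem encode_eq_of_mem (R : StratumSplitting δ p) (o : X) {w : ℕ → ℕ × ℕ}
    (hw : ∀ n, (w n).1 ≤ codeHeight w n + 1) {x : X}
    (hx : ∀ n, x ∈ (R.pieceOfCode o w n).carrier) : R.encode o x = w := by
  funext n
  induction n using Nat.strong_induction_on with
  | _ n ih =>
    have h := hx (n + 1)
    rw [R.pieceOfCode_carrier_succ o hw] at h
    rw [encode, piece_eq_pieceOfCode, R.pieceOfCode_congr o ih]
    exact h.2

theorem continuous_encode (R : StratumSplitting δ p) (o : X) : Continuous (R.encode o) := by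
  have hpiece : ∀ n x, ∀ᶠ y in 𝓝 x, R.piece o y n = R.piece o x n := by
    intro n x
    induction n with
    | zero => exact .of_forall fun _ => rfl
    | succ n ih =>
      filter_upwards [ih, (R.isLocallyConstant_code n (R.piece o x n)).eventually_eq x]
        with y h1 h2
      rw [piece, piece, h1, h2]
  refine continuous_pi fun n => IsLocallyConstant.continuous ?_
  rw [IsLocallyConstant.iff_eventually_eq]
  intro x
  filter_upwards [hpiece n x, (R.isLocallyConstant_code n (R.piece o x n)).eventually_eq x]
    with y h1 h2
  rw [encode, encode, h1, h2]

theorem isEmbedding_encode (S : IsStratification δ p) [T2Space X] (R : StratumSplitting δ p)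
    (o : X) : IsEmbedding (R.encode o) := by
  refine IsInducing.isEmbedding (isInducing_iff_nhds.2 fun x => le_antisymm
    (R.continuous_encode o).continuousAt.le_comap fun U hU => ?_)
  obtain ⟨m, hm⟩ := S.exists_cell_subset x U hU
  refine mem_comap.2 ⟨{w | ∀ i ∈ Finset.range (m + 1), w i = R.encode o x i}, ?_, fun y hy => ?_⟩
  · change ∀ᶠ w in 𝓝 (R.encode o x), _
    rw [Finset.eventually_all]
    intro i _
    filter_upwards [(continuous_apply i).continuousAt.preimage_mem_nhds
      ((isOpen_discrete {R.encode o x i}).mem_nhds rfl)] with w hw using hw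
  · refine hm y (R.cell_eq_of_mem o (R.encode_le o x) (m := m) ?_ (R.mem_pieceOfCode_encode o x _))
    rw [← R.pieceOfCode_congr o fun i hi => hy i (Finset.mem_range.2 hi)]
    exact R.mem_pieceOfCode_encode o y _

theorem codeSpace_subset_range (S : IsStratification δ p) (R : StratumSplitting δ p) (o : X) :
    codeSpace ⊆ range (R.encode o) := by
  rintro w ⟨hw, hlim⟩
  obtain ⟨x, hx⟩ := S.exists_lim (fun n => (R.pieceOfCode o w n).point) fun k => by
    obtain ⟨N, hN⟩ := eventually_atTop.1 (hlim.eventually_ge_atTop k)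
    exact ⟨N, fun n hn => point_eq_of_le S R o hw hN hn⟩
  refine ⟨x, R.encode_eq_of_mem o hw fun n => ?_⟩
  refine (R.pieceOfCode o w n).isClopen.isClosed.mem_of_tendsto hx ?_
  filter_upwards [eventually_ge_atTop n] with m hm
  exact R.antitone_carrier o hw hm (R.pieceOfCode o w m).mem

theorem encode_mem_codeSpace (S : IsStratification δ p) (R : StratumSplitting δ p) (o x : X) :
    R.encode o x ∈ codeSpace := by
  set w := R.encode o x with hwdef
  have hw : ∀ n, (w n).1 ≤ codeHeight w n + 1 := R.encode_le o x
  have hxm : ∀ n, x ∈ (R.pieceOfCode o w n).carrier := R.mem_pieceOfCode_encode o x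
  have hlim : Tendsto (fun n => (R.pieceOfCode o w n).point) atTop (𝓝 x) := by
    intro U hU
    obtain ⟨m, hm⟩ := S.exists_cell_subset x U hU
    change ∀ᶠ n in atTop, (R.pieceOfCode o w n).point ∈ U
    filter_upwards [eventually_ge_atTop (m + 1)] with n hn
    exact hm _ (R.cell_eq_of_mem o hw (R.antitone_carrier o hw hn (R.pieceOfCode o w n).mem)
      (hxm _))
  refine ⟨hw, tendsto_atTop.2 fun k => ?_⟩
  induction k with
  | zero => exact .of_forall fun _ => Nat.zero_le _
  | succ k ih =>
    obtain ⟨N, hN⟩ := eventually_atTop.1 ih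
    have hpx : ∀ n ≥ N, p k (R.pieceOfCode o w n).point = p k x := by
      intro n hn
      have hxN : x ∈ {y | p k y = p k (R.pieceOfCode o w N).point} := by
        refine (S.isClosed_stratum k _).mem_of_tendsto hlim ?_
        filter_upwards [eventually_ge_atTop N] with i hi using point_eq_of_le S R o hw hN hi
      exact (point_eq_of_le S R o hw hN hn).trans (Eq.symm hxN)
    by_contra hcon
    have hfreq : ∀ M, ∃ n ≥ M, n ≥ N ∧ codeHeight w n = k := by
      intro M
      by_contra! hM
      refine hcon (eventually_atTop.2 ⟨max M N, fun n hn => ?_⟩)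
      have h1 := hM n (le_of_max_le_left hn) (le_of_max_le_right hn)
      have h2 := hN n (le_of_max_le_right hn)
      omega
    have havoid : ∀ L, ∃ M, ∀ y ∈ (R.pieceOfCode o w M).carrier, p k y = p k x →
        L ≤ p (k + 1) y := by
      intro L
      induction L with
      | zero => exact ⟨0, fun _ _ _ => Nat.zero_le _⟩
      | succ L ihL =>
        obtain ⟨M, hM⟩ := ihL
        obtain ⟨n, hnM, hnN, hnk⟩ := hfreq M
        obtain ⟨n', hn', -, hn'k⟩ := hfreq (n + 1)
        have hnh := (R.pieceOfCode_height o hw n).trans hnk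
        have hmin := R.anchor_minimal n (R.pieceOfCode o w n)
        rw [hnh, hpx n hnN] at hmin
        set l := p (k + 1) (R.anchor n (R.pieceOfCode o w n)) with hl
        have hstep : ∀ i ≥ n, (i = n ∨ (k + 1 ≤ codeHeight w i ∧
              p (k + 1) (R.pieceOfCode o w i).point = l) ∨
            ∀ y ∈ (R.pieceOfCode o w i).carrier, p (k + 1) y ≠ l) →
            ((k + 1 ≤ codeHeight w (i + 1) ∧
              p (k + 1) (R.pieceOfCode o w (i + 1)).point = l) ∨
            ∀ y ∈ (R.pieceOfCode o w (i + 1)).carrier, p (k + 1) y ≠ l) := by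
          intro i hi hcase
          have hcarr := R.pieceOfCode_carrier_succ o hw i
          have hanchor : p (k + 1) (R.anchor i (R.pieceOfCode o w i)) = l →
              ((k + 1 ≤ codeHeight w (i + 1) ∧
                p (k + 1) (R.pieceOfCode o w (i + 1)).point = l) ∨
              ∀ y ∈ (R.pieceOfCode o w (i + 1)).carrier, p (k + 1) y ≠ l) := by
            intro hal
            by_cases hki : k + 1 ≤ codeHeight w (i + 1)
            · exact .inl ⟨hki, (point_succ S R o hw hki).trans hal⟩
            · have hwk : (w i).1 = k := by
                have : k ≤ codeHeight w (i + 1) := hN (i + 1) (by omega)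
                change ¬ (k + 1 ≤ (w i).1) at hki
                change k ≤ (w i).1 at this
                omega
              refine .inr fun y hy => ?_
              rw [hcarr] at hy
              have := R.code_avoids i _ y hy.1
              rw [show R.code i (R.pieceOfCode o w i) y = w i from hy.2, hwk, hal,
                R.pieceOfCode_height o hw] at this
              exact this (hN i (by omega))
          rcases hcase with rfl | ⟨h1, h2⟩ | h
          · exact hanchor rfl
          · exact hanchor ((anchor_pieceOfCode S R o hw h1).trans h2)
          · refine .inr fun y hy => h y ?_
            rw [hcarr] at hy
            exact hy.1
        have hall : ∀ i ≥ n + 1, (k + 1 ≤ codeHeight w i ∧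
              p (k + 1) (R.pieceOfCode o w i).point = l) ∨
            ∀ y ∈ (R.pieceOfCode o w i).carrier, p (k + 1) y ≠ l := by
          intro i hi
          induction i, hi using Nat.le_induction with
          | base => exact hstep n le_rfl (.inl rfl)
          | succ i hi ih => exact hstep i (by omega) (.inr ih)
        refine ⟨n', fun y hy hyx => ?_⟩
        have hyn := R.antitone_carrier o hw (show n ≤ n' by omega) hy
        have h1 := hM y (R.antitone_carrier o hw hnM hyn) hyx
        have h2 := hmin y hyn hyx
        rcases hall n' hn' with h | h
        · omega
        · have h3 := h y hy
          have h4 : L ≤ l := hM _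
            (R.antitone_carrier o hw hnM (R.anchor_mem n (R.pieceOfCode o w n)))
            ((anchor_pieceOfCode S R o hw hnk.ge).trans (hpx n hnN))
          omega
    obtain ⟨M, hM⟩ := havoid (p (k + 1) x + 1)
    have := hM x (hxm M) rfl
    omega

end StratumSplitting

/-- All nonempty stratified spaces are homeomorphic to the universal code space. -/
theorem IsStratification.nonempty_homeomorph_codeSpace {X : Type*} [TopologicalSpace X]
    [T2Space X] [Nonempty X] {δ p : ℕ → X → ℕ} (S : IsStratification δ p) :
    Nonempty (X ≃ₜ codeSpace) := by
  obtain ⟨R⟩ := S.nonempty_splitting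
  let o : X := Classical.arbitrary X
  have hrange : range (R.encode o) = codeSpace :=
    (range_subset_iff.2 (R.encode_mem_codeSpace S o)).antisymm (R.codeSpace_subset_range S o)
  exact ⟨(R.isEmbedding_encode S o).toHomeomorph.trans (Homeomorph.setCongr hrange)⟩

theorem exists_injOn_finite_code (Y : Type*) [Countable Y] :
    ∃ c : Set Y → ℕ, InjOn c {s | s.Finite} :=
  countable_iff_exists_injOn.1 Countable.ofPred_finite

/-- A numbering of the finite subsets of a countable type. -/
noncomputable def finiteCode (Y : Type*) [Countable Y] : Set Y → ℕ :=
  (exists_injOn_finite_code Y).choose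

theorem finiteCode_inj {Y : Type*} [Countable Y] {s t : Set Y} (hs : s.Finite) (ht : t.Finite) :
    finiteCode Y s = finiteCode Y t ↔ s = t :=
  (exists_injOn_finite_code Y).choose_spec.eq_iff hs ht

namespace FinHypN

variable {n : ℕ} {X Y : Type*}

theorem finite (A : FinHypN n X) : A.1.Finite := finite_of_encard_le_coe A.2.2

/-- The image of a member of `ℱₙ(X)` under a map `X → Y`. -/
def map (f : X → Y) (A : FinHypN n X) : FinHypN n Y :=
  ⟨f '' A.1, A.2.1.image f, (encard_image_le f A.1).trans A.2.2⟩

/-- The number of the finite set `f '' A`. -/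
noncomputable def imageCode [Countable Y] (f : X → Y) (A : FinHypN n X) : ℕ :=
  finiteCode Y (f '' A.1)

theorem imageCode_eq_iff [Countable Y] {f : X → Y} {A B : FinHypN n X} :
    imageCode f A = imageCode f B ↔ f '' A.1 = f '' B.1 :=
  finiteCode_inj (A.finite.image f) (B.finite.image f)

theorem imageCode_eq_of_comp {Z : Type*} [Countable Y] [Countable Z] {f : X → Y} {g : X → Z}
    (φ : Y → Z) (hφ : ∀ x, g x = φ (f x)) {A B : FinHypN n X}
    (h : imageCode f A = imageCode f B) : imageCode g A = imageCode g B := by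
  rw [imageCode_eq_iff] at h ⊢
  have hg : g = φ ∘ f := funext hφ
  rw [hg, image_comp, image_comp, h]

variable [TopologicalSpace X]

theorem tendsto_iff {ι : Type*} {l : Filter ι} {u : ι → FinHypN n X} {A : FinHypN n X} :
    Tendsto u l (𝓝 A) ↔
      (∀ U : Set X, IsOpen U → A.1 ⊆ U → ∀ᶠ i in l, (u i).1 ⊆ U) ∧
      (∀ U : Set X, IsOpen U → (A.1 ∩ U).Nonempty → ∀ᶠ i in l, ((u i).1 ∩ U).Nonempty) := by
  have hnhds : 𝓝 A = comap (fun B : FinHypN n X => B.1)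
      (@nhds _ (vietoris ‹TopologicalSpace X›) A.1) :=
    @nhds_induced _ _ (vietoris ‹TopologicalSpace X›) (fun B : FinHypN n X => B.1) A
  rw [hnhds, tendsto_comap_iff]
  refine TopologicalSpace.tendsto_nhds_generateFrom_iff.trans ?_
  constructor
  · exact fun h => ⟨fun U hU hA => h _ (.inl ⟨U, hU, rfl⟩) hA,
      fun U hU hA => h _ (.inr ⟨U, hU, rfl⟩) hA⟩
  · rintro ⟨h1, h2⟩ s (⟨U, hU, rfl⟩ | ⟨U, hU, rfl⟩) hA
    · exact h1 U hU hA
    · exact h2 U hU hA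

theorem eventually_subset {A : FinHypN n X} {U : Set X} (hU : IsOpen U) (h : A.1 ⊆ U) :
    ∀ᶠ B : FinHypN n X in 𝓝 A, B.1 ⊆ U :=
  (tendsto_iff.1 (tendsto_id (x := 𝓝 A))).1 U hU h

theorem eventually_inter {A : FinHypN n X} {U : Set X} (hU : IsOpen U) (h : (A.1 ∩ U).Nonempty) :
    ∀ᶠ B : FinHypN n X in 𝓝 A, (B.1 ∩ U).Nonempty :=
  (tendsto_iff.1 (tendsto_id (x := 𝓝 A))).2 U hU h

theorem isLocallyConstant_imageCode [Countable Y] {f : X → Y} (hf : IsLocallyConstant f) :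
    IsLocallyConstant (imageCode f : FinHypN n X → ℕ) := by
  rw [IsLocallyConstant.iff_eventually_eq]
  intro A
  have h1 := eventually_subset (hf (f '' A.1)) (subset_preimage_image f A.1)
  have h2 : ∀ᶠ B : FinHypN n X in 𝓝 A, ∀ a ∈ A.1, (B.1 ∩ f ⁻¹' {f a}).Nonempty :=
    (eventually_all_finite A.finite).2 fun a ha => eventually_inter (hf {f a}) ⟨a, ha, rfl⟩
  filter_upwards [h1, h2] with B hB1 hB2
  rw [imageCode_eq_iff]
  refine (image_subset_iff.2 hB1).antisymm ?_
  rintro _ ⟨a, ha, rfl⟩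
  obtain ⟨b, hb, hba⟩ := hB2 a ha
  exact ⟨b, hb, hba⟩

theorem isClosed_setOf_imageCode_eq [TopologicalSpace Y] [T1Space Y] [Countable Y] {f : X → Y}
    (hf : Continuous f) (A : FinHypN n X) :
    IsClosed {B : FinHypN n X | imageCode f B = imageCode f A} := by
  rw [← isOpen_compl_iff, isOpen_iff_mem_nhds]
  intro B hB
  have hne : ¬ f '' B.1 = f '' A.1 := fun h => hB (imageCode_eq_iff.2 h)
  rw [Subset.antisymm_iff, not_and_or, not_subset, not_subset] at hne
  rcases hne with ⟨_, ⟨b, hb, rfl⟩, hbA⟩ | ⟨y, hyA, hyB⟩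
  · filter_upwards [eventually_inter ((A.finite.image f).isClosed.isOpen_compl.preimage hf)
      ⟨b, hb, hbA⟩] with C ⟨c, hc, hcA⟩ hCA
    exact hcA (imageCode_eq_iff.1 hCA ▸ mem_image_of_mem f hc)
  · filter_upwards [eventually_subset (U := f ⁻¹' {y}ᶜ) (isOpen_compl_singleton.preimage hf)
      fun b hb hby => hyB ⟨b, hb, hby⟩] with C hC hCA
    rw [← imageCode_eq_iff.1 hCA] at hyA
    obtain ⟨c, hc, hcy⟩ := hyA
    exact hC hc hcy

/-- A net in `ℱₙ(X)` converges to `A` as soon as its images under each member of a refining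
sequence of maps whose fibres shrink to points are eventually those of `A`. -/
theorem tendsto_of_eventually_image_eq {Y : ℕ → Type*} {f : ∀ k, X → Y k}
    (hf : ∀ x, ∀ U ∈ 𝓝 x, ∃ k, ∀ m ≥ k, ∀ y, f m y = f m x → y ∈ U) {ι : Type*} {l : Filter ι}
    {u : ι → FinHypN n X} {A : FinHypN n X}
    (h : ∀ k, ∀ᶠ i in l, f k '' (u i).1 = f k '' A.1) : Tendsto u l (𝓝 A) := by
  refine tendsto_iff.2 ⟨fun U hU hA => ?_, fun U hU ⟨a, ha, haU⟩ => ?_⟩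
  · have hk : ∀ᶠ k in atTop, ∀ a ∈ A.1, ∀ y, f k y = f k a → y ∈ U :=
      (eventually_all_finite A.finite).2 fun a ha =>
        eventually_atTop.2 (hf a U (hU.mem_nhds (hA ha)))
    obtain ⟨k, hk⟩ := hk.exists
    filter_upwards [h k] with i hi x hx
    obtain ⟨a, ha, hax⟩ : f k x ∈ f k '' A.1 := hi ▸ mem_image_of_mem _ hx
    exact hk a ha x hax.symm
  · obtain ⟨k, hk⟩ := hf a U (hU.mem_nhds haU)
    filter_upwards [h k] with i hi
    obtain ⟨x, hx, hxa⟩ : f k a ∈ f k '' (u i).1 := hi ▸ mem_image_of_mem _ ha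
    exact ⟨x, hx, hk k le_rfl x hxa⟩

/-- `X` is homeomorphic to `ℱ₁(X)`. -/
theorem nonempty_homeomorph_one : Nonempty (X ≃ₜ FinHypN 1 X) := by
  let e : X → FinHypN 1 X := fun x => ⟨{x}, singleton_nonempty x, (encard_singleton x).le⟩
  have hsurj : Function.Surjective e := by
    rintro ⟨A, hA, hA1⟩
    obtain ⟨x, rfl⟩ := encard_eq_one.1
      (le_antisymm (by simpa using hA1) (one_le_encard_iff_nonempty.2 hA))
    exact ⟨x, rfl⟩
  have hinj : Function.Injective e := fun x y h => singleton_injective (congrArg Subtype.val h)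
  have hind : IsInducing e := by
    refine isInducing_iff_nhds.2 fun x => le_antisymm ?_ fun U hU => ?_
    · rw [← tendsto_iff_comap]
      refine tendsto_iff.2 ⟨fun U hU h => ?_, fun U hU h => ?_⟩
      · filter_upwards [hU.mem_nhds (h rfl)] with y hy using singleton_subset_iff.2 hy
      · obtain ⟨_, rfl, hx⟩ := h
        filter_upwards [hU.mem_nhds hx] with y hy using ⟨y, rfl, hy⟩
    · obtain ⟨V, hVU, hV, hx⟩ := mem_nhds_iff.1 hU
      exact mem_comap.2 ⟨_, eventually_subset hV (singleton_subset_iff.2 hx),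
        fun y hy => hVU (hy rfl)⟩
  exact ⟨(Equiv.ofBijective e ⟨hinj, hsurj⟩).toHomeomorphOfIsInducing hind⟩

end FinHypN

/-- The first `k` coordinates. -/
def initialSegment (k : ℕ) (x : ℕ → ℚ) : Fin k → ℚ := fun i => x i

theorem initialSegment_eq_iff {k : ℕ} {x y : ℕ → ℚ} :
    initialSegment k x = initialSegment k y ↔ ∀ i < k, x i = y i :=
  ⟨fun h i hi => congrFun h ⟨i, hi⟩, fun h => funext fun i => h i i.2⟩

theorem initialSegment_eq_of_le {k m : ℕ} (hkm : k ≤ m) {x y : ℕ → ℚ}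
    (h : initialSegment m x = initialSegment m y) : initialSegment k x = initialSegment k y :=
  initialSegment_eq_iff.2 fun i hi => initialSegment_eq_iff.1 h i (hi.trans_le hkm)

theorem continuous_initialSegment (k : ℕ) : Continuous (initialSegment k) :=
  continuous_pi fun i => continuous_apply (i : ℕ)

theorem initialSegment_fiber_subset (x : ℕ → ℚ) (U : Set (ℕ → ℚ)) (hU : U ∈ 𝓝 x) :
    ∃ k, ∀ m ≥ k, ∀ y, initialSegment m y = initialSegment m x → y ∈ U := by
  by_contra! h
  choose m hm y hy hyU using h
  have hlim : Tendsto y atTop (𝓝 x) := by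
    refine tendsto_pi_nhds.2 fun i => tendsto_const_nhds.congr' ?_
    filter_upwards [eventually_gt_atTop i] with k hk
    exact (initialSegment_eq_iff.1 (hy k) i (hk.trans_le (hm k))).symm
  obtain ⟨k, hk⟩ := (hlim.eventually hU).exists
  exact hyU k hk

/-- The dissection of `ℚ^ω`, in its first `m` coordinates, by irrational cuts of mesh `1 / m`. -/
noncomputable def dissection (m : ℕ) (x : ℕ → ℚ) : Fin m → Fin m → ℤ :=
  fun i j => ⌊((j : ℕ) + 1 : ℝ) * (x i + √2)⌋

theorem dissection_eq_iff {m : ℕ} {x y : ℕ → ℚ} : dissection m x = dissection m y ↔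
    ∀ i < m, ∀ j < m, ⌊(j + 1 : ℝ) * (x i + √2)⌋ = ⌊(j + 1 : ℝ) * (y i + √2)⌋ :=
  ⟨fun h i hi j hj => congrFun (congrFun h ⟨i, hi⟩) ⟨j, hj⟩,
    fun h => funext fun i => funext fun j => h i i.2 j j.2⟩

theorem isLocallyConstant_dissection (m : ℕ) : IsLocallyConstant (dissection m) := by
  rw [IsLocallyConstant.iff_eventually_eq]
  intro x
  have key : ∀ i j : Fin m, ∀ᶠ y in 𝓝 x, dissection m y i j = dissection m x i j := by
    intro i j
    have hirr : Irrational (((j : ℕ) + 1 : ℝ) * (x i + √2)) := by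
      have := (irrational_sqrt_two.ratCast_add (x i)).natCast_mul (Nat.succ_ne_zero j)
      exact_mod_cast this
    have hcont : Continuous fun y : ℕ → ℚ => ((j : ℕ) + 1 : ℝ) * (y i + √2) := by
      have : Continuous fun y : ℕ → ℚ => (y i : ℝ) :=
        Rat.continuous_coe_real.comp (continuous_apply (i : ℕ))
      fun_prop
    have hlt := lt_of_le_of_ne (Int.floor_le (((j : ℕ) + 1 : ℝ) * (x i + √2)))
      (hirr.ne_int _).symm
    filter_upwards [hcont.continuousAt.eventually_const_lt hlt,
      hcont.continuousAt.eventually_lt_const (Int.lt_floor_add_one _)] with y h1 h2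
    exact Int.floor_eq_iff.2 ⟨h1.le, h2⟩
  filter_upwards [eventually_all.2 fun i => eventually_all.2 (key i)] with y hy
  exact funext fun i => funext fun j => hy i j

theorem dissection_fiber_subset (x : ℕ → ℚ) (U : Set (ℕ → ℚ)) (hU : U ∈ 𝓝 x) :
    ∃ k, ∀ m ≥ k, ∀ y, dissection m y = dissection m x → y ∈ U := by
  by_contra! h
  choose m hm y hy hyU using fun k => h (k + 1)
  have hlim : Tendsto y atTop (𝓝 x) := by
    refine tendsto_pi_nhds.2 fun i => ?_
    refine tendsto_iff_dist_tendsto_zero.2 (squeeze_zero' (.of_forall fun _ => dist_nonneg) ?_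
      tendsto_one_div_add_atTop_nhds_zero_nat)
    filter_upwards [eventually_gt_atTop i] with k hk
    have h1 := Int.abs_sub_lt_one_of_floor_eq_floor
      (dissection_eq_iff.1 (hy k) i (by have := hm k; omega) k (hm k))
    rw [← mul_sub, add_sub_add_right_eq_sub, abs_mul, abs_of_pos (by positivity)] at h1
    rw [Rat.dist_eq, le_div_iff₀ (by positivity), mul_comm]
    exact h1.le
  obtain ⟨k, hk⟩ := (hlim.eventually hU).exists
  exact hyU k hk

namespace FinHypN

variable {n : ℕ}

instance : T2Space (FinHypN n (ℕ → ℚ)) := by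
  refine T2Space.of_injective_continuous (Y := ℕ → ℕ)
    (f := fun A m => imageCode (dissection m) A) (fun A B h => ?_)
    (continuous_pi fun m =>
      (isLocallyConstant_imageCode (isLocallyConstant_dissection m)).continuous)
  have hsub : ∀ A B : FinHypN n (ℕ → ℚ),
      (∀ m, dissection m '' A.1 = dissection m '' B.1) → A.1 ⊆ B.1 := by
    intro A B h a ha
    by_contra haB
    obtain ⟨m, hm⟩ := dissection_fiber_subset a _ (B.finite.isClosed.isOpen_compl.mem_nhds haB)
    obtain ⟨b, hb, hba⟩ : dissection m a ∈ dissection m '' B.1 := h m ▸ mem_image_of_mem _ ha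
    exact hm m le_rfl b hba hb
  have h' : ∀ m, dissection m '' A.1 = dissection m '' B.1 :=
    fun m => imageCode_eq_iff.1 (congrFun h m)
  exact Subtype.ext ((hsub A B h').antisymm (hsub B A fun m => (h' m).symm))

theorem exists_near_of_initialSegment (k : ℕ) (A : FinHypN n (ℕ → ℚ))
    (U : Set (FinHypN n (ℕ → ℚ))) (hU : U ∈ 𝓝 A) :
    ∃ B ∈ U, initialSegment k '' B.1 = initialSegment k '' A.1 ∧
      initialSegment (k + 1) '' B.1 ≠ initialSegment (k + 1) '' A.1 := by
  let shift : ℕ → (ℕ → ℚ) → ℕ → ℚ := fun m x => Function.update x k (x k + 1 / ((m : ℚ) + 1))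
  have hshift : ∀ x, Tendsto (fun m => shift m x) atTop (𝓝 x) := by
    intro x
    have h : Tendsto (fun m : ℕ => x k + 1 / ((m : ℚ) + 1)) atTop (𝓝 (x k)) := by
      simpa using tendsto_const_nhds.add (tendsto_one_div_add_atTop_nhds_zero_nat (𝕜 := ℚ))
    have h' := (tendsto_const_nhds (x := x)).update k h
    rwa [Function.update_eq_self] at h'
  have hlim : Tendsto (fun m => map (shift m) A) atTop (𝓝 A) := by
    refine tendsto_iff.2 ⟨fun V hV hA => ?_, fun V hV ⟨a, ha, haV⟩ => ?_⟩
    · filter_upwards [(eventually_all_finite A.finite).2 fun a ha =>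
        (hshift a).eventually (hV.mem_nhds (hA ha))] with m hm
      exact image_subset_iff.2 hm
    · filter_upwards [(hshift a).eventually (hV.mem_nhds haV)] with m hm
      exact ⟨_, mem_image_of_mem _ ha, hm⟩
  obtain ⟨m, hm⟩ := (hlim.eventually hU).exists
  refine ⟨_, hm, ?_, fun heq => ?_⟩
  · have hcomp : initialSegment k ∘ shift m = initialSegment k := by
      funext x i
      exact Function.update_of_ne i.2.ne _ _
    rw [map, ← image_comp, hcomp]
  · obtain ⟨a, ha, hmax⟩ := exists_max_image A.1 (fun x => x k) A.finite A.2.1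
    obtain ⟨b, hb, hba⟩ : initialSegment (k + 1) (shift m a) ∈ initialSegment (k + 1) '' A.1 :=
      heq ▸ mem_image_of_mem _ (mem_image_of_mem _ ha)
    have h1 : b k = a k + 1 / ((m : ℚ) + 1) := by
      rw [initialSegment_eq_iff.1 hba k k.lt_succ_self]
      exact Function.update_self _ _ _
    have h2 := hmax b hb
    have h3 : (0 : ℚ) < 1 / ((m : ℚ) + 1) := by positivity
    linarith

theorem exists_eventual_limit (a : ℕ → FinHypN n (ℕ → ℚ)) (N : ℕ → ℕ)
    (hN : ∀ k, ∀ i ≥ N k, initialSegment k '' (a i).1 = initialSegment k '' (a (N k)).1) :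
    ∃ A : FinHypN n (ℕ → ℚ), ∀ k, initialSegment k '' A.1 = initialSegment k '' (a (N k)).1 := by
  have hdown : ∀ k l x, k ≤ l → initialSegment l x ∈ initialSegment l '' (a (N l)).1 →
      initialSegment k x ∈ initialSegment k '' (a (N k)).1 := by
    intro k l x hkl hx
    rw [← hN l (max (N k) (N l)) (le_max_right _ _)] at hx
    rw [← hN k (max (N k) (N l)) (le_max_left _ _)]
    obtain ⟨z, hz, hzx⟩ := hx
    exact ⟨z, hz, initialSegment_eq_of_le hkl hzx⟩
  have hup : ∀ k, ∀ x ∈ (a (N k)).1, ∃ y ∈ (a (N (k + 1))).1,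
      initialSegment k y = initialSegment k x := by
    intro k x hx
    have hx' := mem_image_of_mem (initialSegment k) hx
    rw [← hN k (max (N k) (N (k + 1))) (le_max_left _ _)] at hx'
    obtain ⟨z, hz, hzx⟩ := hx'
    have hz' := mem_image_of_mem (initialSegment (k + 1)) hz
    rw [hN (k + 1) _ (le_max_right _ _)] at hz'
    obtain ⟨y, hy, hyz⟩ := hz'
    exact ⟨y, hy, (initialSegment_eq_of_le k.le_succ hyz).trans hzx⟩
  choose! up hup_mem hup_eq using hup
  let A : Set (ℕ → ℚ) := {x | ∀ k, initialSegment k x ∈ initialSegment k '' (a (N k)).1}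
  have hA : ∀ k, initialSegment k '' A = initialSegment k '' (a (N k)).1 := by
    intro k
    refine Subset.antisymm (by rintro _ ⟨x, hx, rfl⟩; exact hx k) ?_
    rintro _ ⟨x, hx, rfl⟩
    let u : ℕ → ℕ → ℚ := fun j => Nat.rec x (fun j y => up (k + j) y) j
    have hu_mem : ∀ j, u j ∈ (a (N (k + j))).1 := by
      intro j
      induction j with
      | zero => exact hx
      | succ j ih => exact hup_mem (k + j) _ ih
    have hu_eq : ∀ i j, i ≤ j → initialSegment (k + i) (u j) = initialSegment (k + i) (u i) := by
      intro i j hij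
      induction j, hij using Nat.le_induction with
      | base => rfl
      | succ j hij ih =>
        exact (initialSegment_eq_of_le (by omega) (hup_eq (k + j) _ (hu_mem j))).trans ih
    let y : ℕ → ℚ := fun i => u (i + 1) i
    have hy : ∀ j, initialSegment (k + j) y = initialSegment (k + j) (u j) := by
      intro j
      refine initialSegment_eq_iff.2 fun i hi => ?_
      rcases le_total (i + 1) j with h | h
      · exact (initialSegment_eq_iff.1 (hu_eq (i + 1) j h) i (by omega)).symm
      · exact initialSegment_eq_iff.1 (hu_eq j (i + 1) h) i hi
    exact ⟨y, fun l => hdown l (k + l) y (by omega) (hy l ▸ mem_image_of_mem _ (hu_mem l)), hy 0⟩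
  have hne : A.Nonempty := by
    have h := (a (N 0)).2.1.image (initialSegment 0)
    rw [← hA 0] at h
    exact h.of_image
  have hcard : A.encard ≤ n := by
    by_contra! hlt
    obtain ⟨F, hFA, hF⟩ := exists_subset_encard_eq (Order.add_one_le_of_lt hlt)
    have hFfin : F.Finite := finite_of_encard_eq_coe (k := n + 1) (by simpa using hF)
    have hinj : ∀ᶠ k in atTop, ∀ x ∈ F, ∀ y ∈ F,
        initialSegment k x = initialSegment k y → x = y := by
      refine (eventually_all_finite hFfin).2 fun x _ => (eventually_all_finite hFfin).2 fun y _ => ?_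
      by_cases hxy : x = y
      · exact .of_forall fun _ _ => hxy
      · obtain ⟨i, hi⟩ := Function.ne_iff.1 hxy
        filter_upwards [eventually_gt_atTop i] with k hk h
        exact absurd (initialSegment_eq_iff.1 h i hk) hi
    obtain ⟨k, hk⟩ := hinj.exists
    have h1 : (initialSegment k '' F).encard = n + 1 :=
      (InjOn.encard_image fun x hx y hy h => hk x hx y hy h).trans hF
    have h2 : (initialSegment k '' F).encard ≤ n :=
      ((encard_le_encard (image_mono hFA)).trans_eq (by rw [hA k])).trans
        ((encard_image_le _ _).trans (a (N k)).2.2)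
    rw [h1] at h2
    exact absurd h2 (by exact_mod_cast Nat.not_succ_le_self n)
  exact ⟨⟨A, hne, hcard⟩, hA⟩

theorem isStratification : IsStratification
    (fun m (A : FinHypN n (ℕ → ℚ)) => imageCode (dissection m) A)
    (fun k (A : FinHypN n (ℕ → ℚ)) => imageCode (initialSegment k) A) where
  isLocallyConstant m := isLocallyConstant_imageCode (isLocallyConstant_dissection m)
  exists_cell_subset A U hU := by
    by_contra! h
    choose B hB hBU using h
    have hlim : Tendsto B atTop (𝓝 A) := by
      refine tendsto_of_eventually_image_eq dissection_fiber_subset fun k => ?_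
      filter_upwards [eventually_ge_atTop k] with m hm
      exact imageCode_eq_iff.1 (imageCode_eq_of_comp
        (fun (z : Fin m → Fin m → ℤ) (i j : Fin k) => z (i.castLE hm) (j.castLE hm))
        (fun _ => rfl) (hB m))
    obtain ⟨m, hm⟩ := (hlim.eventually hU).exists
    exact hBU m hm
  refines m A B h := imageCode_eq_of_comp
    (fun (z : Fin (m + 1) → Fin (m + 1) → ℤ) (i j : Fin m) => z i.castSucc j.castSucc)
    (fun _ => rfl) h
  stratum_refines k A B h := imageCode_eq_of_comp
    (fun (z : Fin (k + 1) → ℚ) (i : Fin k) => z i.castSucc) (fun _ => rfl) h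
  stratum_zero A B := by
    have huniv : ∀ C : FinHypN n (ℕ → ℚ), initialSegment 0 '' C.1 = univ := fun C =>
      Subsingleton.eq_univ_of_nonempty (C.2.1.image _)
    exact imageCode_eq_iff.2 ((huniv A).trans (huniv B).symm)
  isClosed_stratum k A := isClosed_setOf_imageCode_eq (continuous_initialSegment k) A
  exists_near k A U hU := by
    simpa only [Ne, imageCode_eq_iff] using exists_near_of_initialSegment k A U hU
  exists_lim a ha := by
    choose N hN using ha
    obtain ⟨A, hA⟩ := exists_eventual_limit a N fun k i hi => imageCode_eq_iff.1 (hN k i hi)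
    refine ⟨A, tendsto_of_eventually_image_eq initialSegment_fiber_subset fun k => ?_⟩
    filter_upwards [eventually_ge_atTop (N k)] with i hi
    exact (imageCode_eq_iff.1 (hN k i hi)).trans (hA k).symm

theorem nonempty_homeomorph_codeSpace (hn : 0 < n) :
    Nonempty (FinHypN n (ℕ → ℚ) ≃ₜ codeSpace) := by
  have : Nonempty (FinHypN n (ℕ → ℚ)) :=
    ⟨⟨{0}, singleton_nonempty 0, by rw [encard_singleton]; exact_mod_cast hn⟩⟩
  exact isStratification.nonempty_homeomorph_codeSpace

end FinHypN

/-- For every `n ≥ 1`, the Vietoris hyperspace `ℱₙ(ℚ^ω)` of nonempty subsets of `ℚ^ω`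
of cardinality at most `n` is homeomorphic to `ℚ^ω`. -/
theorem finHypN_rationalPower_homeomorph (n : ℕ) (hn : 0 < n) :
    Nonempty (FinHypN n (ℕ → ℚ) ≃ₜ (ℕ → ℚ)) := by
  obtain ⟨e⟩ := FinHypN.nonempty_homeomorph_codeSpace hn
  obtain ⟨f⟩ := FinHypN.nonempty_homeomorph_codeSpace Nat.one_pos
  obtain ⟨g⟩ := FinHypN.nonempty_homeomorph_one (X := ℕ → ℚ)
  exact ⟨e.trans (f.symm.trans g.symm)⟩
end
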